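/- Let $\mathbb{D}$ be the open unit disk in $\mathbb{C}$. For $0<p<\infty$ let $H^p$ be the Hardy space of analytic functions $f$ on $\mathbb{D}$ with $$\|f\|_{H^p}=\sup_{0<r<1}\Big(\frac1{2\pi}\int_0^{2\pi}|f(re^{i\theta})|^p\,d\theta\Big)^{1/p}<\infty,$$ and let $\mathcal{B}$ be the Bloch space of analytic functions $f$ on $\mathbb{D}$ with $\|f\|_{\mathcal{B}}=|f(0)|+\sup_{z\in\mathbb{D}}(1-|z|^2)|f'(z)|<\infty$. For $s>0$, a positive Borel measure $\mu$ on $[0,1)$ is an $s$-Carleson measure if there is $C>0$ with $\mu([t,1))\le C(1-t)^s$ for all $0\le t<1$ (in particular $\mu$ is then finite), and a vanishing $s$-Carleson measure if $\mu([t,1))/(1-t)^s\to0$ as $t\to1^-$. For $\alpha>0$ and an analytic function $f(z)=\sum_{k\ge0}a_kz^k$ on $\mathbb{D}$, put $$\mathcal{H}_{\mu,\alpha}(f)(z)=\sum_{n=0}^\infty\Big(\sum_{k=0}^\infty\mu_{n,k,\alpha}\,a_k\Big)z^n,\qquad \mu_{n,k,\alpha}=\frac{\Gamma(n+\alpha)}{n!\,\Gamma(\alpha)}\int_{[0,1)}t^{n+k}\,d\mu(t).$$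 Let $0<p<\infty$ and $\alpha>1$, and let $\mu$ be a positive Borel measure on $[0,1)$ that is a $1/p$-Carleson measure if $p\le1$, and a $1$-Carleson measure if $p>1$ (under this condition the series above converge and define an analytic function on $\mathbb{D}$ for every $f\in H^p$). Then $\mathcal{H}_{\mu,\alpha}$ is a compact operator from $H^p$ into $\mathcal{B}$ (that is, it is bounded from $H^p$ into $\mathcal{B}$ and the image of every bounded sequence in $H^p$ has a subsequence converging in $\mathcal{B}$) if and only if $\mu$ is a vanishing $(1/p+\alpha)$-Carleson measure. -/

import Mathlib

open MeasureTheory Metric Filter Topology Set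

noncomputable section

/-- The set of `p`-th integral means `M_p(r, f)`, `0 < r < 1`, used to define the Hardy norm. -/
def hardySet (p : ℝ) (f : ℂ → ℂ) : Set ℝ :=
  {y | ∃ r : ℝ, 0 < r ∧ r < 1 ∧
    y = ((2 * Real.pi)⁻¹ *
      ∫ θ in (0:ℝ)..(2 * Real.pi), ‖f ((r : ℂ) * Complex.exp (θ * Complex.I))‖ ^ p) ^ (1 / p)}

/-- The Hardy space (quasi-)norm `‖f‖_{H^p}`. -/
def hardyNorm (p : ℝ) (f : ℂ → ℂ) : ℝ := sSup (hardySet p f)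

/-- Membership in the Hardy space `H^p` of the unit disk (only the values of `f` on the open
unit disk matter). -/
def MemHp (p : ℝ) (f : ℂ → ℂ) : Prop :=
  DifferentiableOn ℂ f (ball (0:ℂ) 1) ∧ BddAbove (hardySet p f)

/-- The set of values `(1-|z|²)|f'(z)|` used to define the Bloch norm. -/
def blochSet (f : ℂ → ℂ) : Set ℝ :=
  {y | ∃ z : ℂ, ‖z‖ < 1 ∧ y = (1 - ‖z‖ ^ 2) * ‖deriv f z‖}

/-- The Bloch norm `‖f‖_ℬ = |f(0)| + sup_{z∈𝔻}(1-|z|²)|f'(z)|`. -/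
def blochNorm (f : ℂ → ℂ) : ℝ := ‖f 0‖ + sSup (blochSet f)

/-- Membership in the Bloch space `ℬ`. -/
def MemBloch (f : ℂ → ℂ) : Prop :=
  DifferentiableOn ℂ f (ball (0:ℂ) 1) ∧ BddAbove (blochSet f)

/-- `μ` is an `s`-Carleson measure on `[0,1)`. The inequality is one in `[0,∞]`; at `t = 0` it
forces `μ([0,1)) < ∞`. -/
def IsCarleson (μ : Measure ℝ) (s : ℝ) : Prop :=
  ∃ C : ℝ, 0 < C ∧ ∀ t : ℝ, 0 ≤ t → t < 1 → μ (Ico t 1) ≤ ENNReal.ofReal (C * (1 - t) ^ s)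

/-- `μ` is a vanishing `s`-Carleson measure on `[0,1)`; the quotient is taken in `[0,∞]`. -/
def IsVanishingCarleson (μ : Measure ℝ) (s : ℝ) : Prop :=
  Tendsto (fun t : ℝ => μ (Ico t 1) / ENNReal.ofReal ((1 - t) ^ s)) (𝓝[<] (1:ℝ)) (𝓝 0)

/-- Condition (T1) for the exponent `p > 0`: `μ` is a `1/p`-Carleson measure when `p ≤ 1`,
and a 1-Carleson measure when `p > 1`. -/
def CondT1 (p : ℝ) (μ : Measure ℝ) : Prop :=
  (p ≤ 1 → IsCarleson μ (1 / p)) ∧ (1 < p → IsCarleson μ 1)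

/-- The entries `μ_{n,k,α} = (Γ(n+α)/(n! Γ(α))) ∫_{[0,1)} t^{n+k} dμ(t)` of the
generalized Hankel matrix. -/
def muCoef (μ : Measure ℝ) (α : ℝ) (n k : ℕ) : ℝ :=
  (Real.Gamma (n + α) / (n.factorial * Real.Gamma α)) * ∫ t in Ico (0:ℝ) 1, t ^ (n + k) ∂μ

/-- The `k`-th Taylor coefficient of `f` at the origin. -/
def taylorCoeff (f : ℂ → ℂ) (k : ℕ) : ℂ := iteratedDeriv k f 0 / (k.factorial : ℂ)

/-- The generalized Hilbert operator
`𝓗_{μ,α}(f)(z) = Σ_n (Σ_k μ_{n,k,α} a_k) z^n`, where `a_k` are the Taylor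
coefficients of `f`. -/
def Hop (μ : Measure ℝ) (α : ℝ) (f : ℂ → ℂ) : ℂ → ℂ :=
  fun z => ∑' n : ℕ, (∑' k : ℕ, (muCoef μ α n k : ℂ) * taylorCoeff f k) * z ^ n

/-- `𝓗_{μ,α}` is a bounded operator from `H^p` into the Bloch space `ℬ`. -/
def BoundedHpToBloch (μ : Measure ℝ) (α p : ℝ) : Prop :=
  (∀ f : ℂ → ℂ, MemHp p f → MemBloch (Hop μ α f)) ∧
  ∃ C : ℝ, 0 < C ∧ ∀ f : ℂ → ℂ, MemHp p f → blochNorm (Hop μ α f) ≤ C * hardyNorm p f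

/-- `𝓗_{μ,α}` is a compact operator from `H^p` into the Bloch space `ℬ`: it is bounded, and the
image of every sequence bounded in `H^p` has a subsequence converging in `ℬ`. -/
def CompactHpToBloch (μ : Measure ℝ) (α p : ℝ) : Prop :=
  BoundedHpToBloch μ α p ∧
  ∀ F : ℕ → ℂ → ℂ, (∀ n, MemHp p (F n)) → (∃ M : ℝ, ∀ n, hardyNorm p (F n) ≤ M) →
    ∃ (φ : ℕ → ℕ) (g : ℂ → ℂ), StrictMono φ ∧ MemBloch g ∧
      Tendsto (fun n => blochNorm (fun z => Hop μ α (F (φ n)) z - g z)) atTop (𝓝 0)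

end

noncomputable section

/-- The weight `Γ(n+α)/(n! Γ(α))`, the `n`-th Taylor coefficient of `(1-z)^(-α)`. -/
def hilbertWeight (α : ℝ) (n : ℕ) : ℝ :=
  Real.Gamma (n + α) / (n.factorial * Real.Gamma α)

lemma hilbertWeight_pos {α : ℝ} (hα : 0 < α) (n : ℕ) : 0 < hilbertWeight α n := by
  unfold hilbertWeight
  have h1 := Real.Gamma_pos_of_pos hα
  have h2 : 0 < Real.Gamma (n + α) := Real.Gamma_pos_of_pos (by positivity)
  positivity

lemma Gamma_nat_add_eq_prod {α : ℝ} (hα : 0 < α) (n : ℕ) :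
    Real.Gamma (n + α) = (∏ j ∈ Finset.range n, (α + j)) * Real.Gamma α := by
  induction n with
  | zero => simp
  | succ n ih =>
    rw [Finset.prod_range_succ]
    have h : ((n + 1 : ℕ) : ℝ) + α = (n + α) + 1 := by push_cast; ring
    rw [h, Real.Gamma_add_one (by positivity), ih]
    ring

lemma hilbertWeight_tendsto {α : ℝ} (hα : 0 < α) :
    Tendsto (fun n : ℕ => hilbertWeight α n / ((n : ℝ) + 1) ^ (α - 1)) atTop
      (𝓝 (Real.Gamma α)⁻¹) := by
  have hG := Real.Gamma_pos_of_pos hα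
  have h1 : Tendsto (fun n : ℕ => (Real.GammaSeq α n)⁻¹) atTop (𝓝 (Real.Gamma α)⁻¹) :=
    (Real.GammaSeq_tendsto_Gamma α).inv₀ hG.ne'
  have hx : Tendsto (fun n : ℕ => (n : ℝ) / ((n : ℝ) + 1)) atTop (𝓝 1) :=
    tendsto_natCast_div_add_atTop 1
  have h2 : Tendsto (fun n : ℕ => ((n : ℝ) / ((n : ℝ) + 1)) ^ α) atTop (𝓝 1) := by
    simpa using hx.rpow_const (p := α) (Or.inl one_ne_zero)
  have h3 : Tendsto (fun n : ℕ => 1 + (α - 1) * (1 / ((n : ℝ) + 1))) atTop (𝓝 1) := by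
    simpa using (tendsto_one_div_add_atTop_nhds_zero_nat (𝕜 := ℝ)).const_mul (α - 1) |>.const_add 1
  have h4 := (h1.mul h2).div h3 one_ne_zero
  simp only [mul_one, div_one] at h4
  refine h4.congr' ?_
  filter_upwards [eventually_gt_atTop 0] with n hn
  have hn' : (0 : ℝ) < n := by exact_mod_cast hn
  have hP : 0 < ∏ j ∈ Finset.range n, (α + (j : ℝ)) :=
    Finset.prod_pos fun j _ => by positivity
  simp only [Pi.div_apply]
  rw [Real.GammaSeq, hilbertWeight, Gamma_nat_add_eq_prod hα, Finset.prod_range_succ,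
    Real.div_rpow hn'.le (by positivity), Real.rpow_sub_one (by positivity)]
  have e : 1 + (α - 1) * (1 / ((n : ℝ) + 1)) = (α + n) / (n + 1) := by field_simp; ring
  rw [e]
  have : 0 < (n : ℝ) ^ α := by positivity
  have : 0 < ((n : ℝ) + 1) ^ α := by positivity
  have : 0 < α + n := by positivity
  field_simp

/-- Two-sided power bounds for the weights. -/
lemma exists_hilbertWeight_bounds {α : ℝ} (hα : 0 < α) :
    ∃ c C : ℝ, 0 < c ∧ 0 < C ∧ ∀ n : ℕ, c * ((n : ℝ) + 1) ^ (α - 1) ≤ hilbertWeight α n ∧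
      hilbertWeight α n ≤ C * ((n : ℝ) + 1) ^ (α - 1) := by
  have hG := Real.Gamma_pos_of_pos hα
  have ht := hilbertWeight_tendsto hα
  have hpos : ∀ n : ℕ, 0 < hilbertWeight α n / ((n : ℝ) + 1) ^ (α - 1) := fun n =>
    div_pos (hilbertWeight_pos hα n) (by positivity)
  obtain ⟨C, hC⟩ := ht.bddAbove_range
  obtain ⟨D, hD⟩ := (ht.inv₀ (inv_pos.2 hG).ne').bddAbove_range
  have hC' := fun n => hC (mem_range_self n)
  have hD' := fun n => hD (mem_range_self n)
  have hCpos : 0 < C := (hpos 0).trans_le (hC' 0)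
  have hDpos : 0 < D := (inv_pos.2 (hpos 0)).trans_le (hD' 0)
  refine ⟨D⁻¹, C, inv_pos.2 hDpos, hCpos, fun n => ⟨?_, ?_⟩⟩
  · have := inv_le_of_inv_le₀ (hpos n) (hD' n)
    rwa [le_div_iff₀ (by positivity)] at this
  · have := hC' n
    rwa [div_le_iff₀ (by positivity)] at this

/-- If `μ` has smaller tails than `ν`, then increasing functions have smaller `μ`-integrals. -/
lemma lintegral_le_of_tail_le {μ ν : Measure ℝ} {w : ℝ → ℝ}
    (hw : MonotoneOn w (Ico 0 1)) (hw0 : ∀ t ∈ Ico (0:ℝ) 1, 0 ≤ w t)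
    (hwc : ContinuousOn w (Ico 0 1))
    (h : ∀ t : ℝ, 0 ≤ t → t < 1 → μ (Ico t 1) ≤ ν (Ico t 1)) :
    ∫⁻ t in Ico 0 1, ENNReal.ofReal (w t) ∂μ ≤ ∫⁻ t in Ico 0 1, ENNReal.ofReal (w t) ∂ν := by
  have hlc : ∀ ρ : Measure ℝ, ∫⁻ t in Ico 0 1, ENNReal.ofReal (w t) ∂ρ =
      ∫⁻ l in Ioi 0, ρ ({a | l ≤ w a} ∩ Ico 0 1) := by
    intro ρ
    rw [lintegral_eq_lintegral_meas_le]
    · refine lintegral_congr fun l => ?_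
      rw [Measure.restrict_apply' measurableSet_Ico]
    · exact (ae_restrict_iff' measurableSet_Ico).2 (Eventually.of_forall hw0)
    · exact hwc.aemeasurable measurableSet_Ico
  rw [hlc, hlc]
  refine lintegral_mono fun l => ?_
  set S := {a | l ≤ w a} ∩ Ico (0:ℝ) 1 with hS
  rcases S.eq_empty_or_nonempty with he | hne
  · simp [he]
  have hbb : BddBelow S := ⟨0, fun x hx => hx.2.1⟩
  set m := sInf S with hm
  obtain ⟨x, hx⟩ := hne
  have hm0 : 0 ≤ m := le_csInf ⟨x, hx⟩ fun y hy => hy.2.1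
  have hm1 : m < 1 := (csInf_le hbb hx).trans_lt hx.2.2
  have hmS : m ∈ S := by
    refine ⟨?_, hm0, hm1⟩
    have hmc : m ∈ closure S := csInf_mem_closure ⟨x, hx⟩ hbb
    have hcw : ContinuousWithinAt w S m :=
      (hwc m ⟨hm0, hm1⟩).mono inter_subset_right
    have : w m ∈ closure (Ici l) := hcw.mem_closure hmc fun y hy => hy.1
    simpa using this
  have hSe : S = Ico m 1 := by
    ext y
    refine ⟨fun hy => ⟨csInf_le hbb hy, hy.2.2⟩, fun hy => ?_⟩
    have hy' : y ∈ Ico (0:ℝ) 1 := ⟨hm0.trans hy.1, hy.2⟩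
    exact ⟨le_trans hmS.1 (hw hmS.2 hy' hy.1), hy'⟩
  rw [hSe]
  exact h m hm0 hm1

lemma lintegral_one_sub_rpow {s C : ℝ} (hs : 0 < s) (hC : 0 ≤ C) {t : ℝ} (ht : t < 1) :
    ∫⁻ u in Ico t 1, ENNReal.ofReal (C * (s * (1 - u) ^ (s - 1))) =
      ENNReal.ofReal (C * (1 - t) ^ s) := by
  have hi : IntervalIntegrable (fun u : ℝ => (1 - u) ^ (s - 1)) volume t 1 := by
    have := (intervalIntegral.intervalIntegrable_rpow' (a := 1 - t) (b := 0) (r := s - 1)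
      (by linarith)).comp_sub_left (1:ℝ)
    simpa using this
  rw [← ofReal_integral_eq_lintegral_ofReal]
  · congr 1
    rw [integral_Ico_eq_integral_Ioc, ← intervalIntegral.integral_of_le ht.le,
      intervalIntegral.integral_const_mul, intervalIntegral.integral_const_mul,
      intervalIntegral.integral_comp_sub_left (fun x => x ^ (s - 1)) (1:ℝ),
      integral_rpow (Or.inl (by linarith))]
    simp only [sub_self, sub_add_cancel]
    rw [Real.zero_rpow hs.ne']
    field_simp
    ring
  · rw [Measure.restrict_congr_set Ico_ae_eq_Ioc, ← IntegrableOn,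
      ← intervalIntegrable_iff_integrableOn_Ioc_of_le ht.le]
    exact (hi.const_mul s).const_mul C
  · refine (ae_restrict_iff' measurableSet_Ico).2 (Eventually.of_forall fun u hu => ?_)
    have : 0 ≤ 1 - u := by linarith [hu.2]
    simp only [Pi.zero_apply]
    positivity

lemma lintegral_pow_mul_one_sub_rpow (n : ℕ) {b : ℝ} (hb : 0 < b) :
    ∫⁻ u in Ico (0:ℝ) 1, ENNReal.ofReal (u ^ n * (1 - u) ^ (b - 1)) =
      ENNReal.ofReal (ProbabilityTheory.beta (n + 1) b) := by
  have hβ : 0 < ProbabilityTheory.beta ((n:ℝ) + 1) b :=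
    ProbabilityTheory.beta_pos (by positivity) hb
  have h := ProbabilityTheory.lintegral_betaPDF_eq_one (α := (n:ℝ) + 1) (by positivity) hb
  rw [ProbabilityTheory.lintegral_betaPDF] at h
  have : ∫⁻ u in Ico (0:ℝ) 1, ENNReal.ofReal (u ^ n * (1 - u) ^ (b - 1)) =
      ENNReal.ofReal (ProbabilityTheory.beta (n + 1) b) * 1 := by
    rw [← h, ← lintegral_const_mul' _ _ ENNReal.ofReal_ne_top, setLIntegral_congr Ioo_ae_eq_Ico.symm]
    refine setLIntegral_congr_fun measurableSet_Ioo fun u hu => ?_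
    rw [← ENNReal.ofReal_mul hβ.le]
    congr 1
    rw [add_sub_cancel_right, Real.rpow_natCast]
    field_simp
  rw [this, mul_one]

/-- Moments of the singular weight `(1-t)^(-q)` against a measure with tails `O((1-t)^s)`. -/
lemma exists_lintegral_pow_mul_le {s q : ℝ} (hq : 0 ≤ q) (hqs : q < s) :
    ∃ K : ℝ, 0 < K ∧ ∀ (μ : Measure ℝ) (C : ℝ), 0 ≤ C →
      (∀ t : ℝ, 0 ≤ t → t < 1 → μ (Ico t 1) ≤ ENNReal.ofReal (C * (1 - t) ^ s)) → ∀ n : ℕ,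
      ∫⁻ t in Ico 0 1, ENNReal.ofReal (t ^ n * (1 - t) ^ (-q)) ∂μ ≤
        ENNReal.ofReal (C * K * ((n : ℝ) + 1) ^ (-(s - q))) := by
  have hs : 0 < s := hq.trans_lt hqs
  have hb : 0 < s - q := sub_pos.2 hqs
  obtain ⟨c, _, hc, _, hcb⟩ := exists_hilbertWeight_bounds (α := s - q + 1) (by positivity)
  have hG := Real.Gamma_pos_of_pos hb
  have hG1 : 0 < Real.Gamma (s - q + 1) := Real.Gamma_pos_of_pos (by positivity)
  refine ⟨s * (Real.Gamma (s - q) / Real.Gamma (s - q + 1) / c), by positivity,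
    fun μ C hC hμ n => ?_⟩
  set ν : Measure ℝ := volume.withDensity fun u => ENNReal.ofReal (C * (s * (1 - u) ^ (s - 1)))
    with hν
  have hmd : Measurable fun u : ℝ => ENNReal.ofReal (C * (s * (1 - u) ^ (s - 1))) := by fun_prop
  have hle := lintegral_le_of_tail_le (μ := μ) (ν := ν) (w := fun t => t ^ n * (1 - t) ^ (-q))
    (by
      intro x hx y hy hxy
      have h1 : 0 < 1 - y := by linarith [hy.2]
      have h2 : 0 < 1 - x := by linarith [hx.2]
      exact mul_le_mul (pow_le_pow_left₀ hx.1 hxy n)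
        (Real.rpow_le_rpow_of_nonpos h1 (by linarith) (by linarith)) (by positivity)
        (pow_nonneg hy.1 n))
    (fun t ht => mul_nonneg (pow_nonneg ht.1 n) (Real.rpow_nonneg (by linarith [ht.2]) _))
    (by
      refine ContinuousOn.mul (by fun_prop) (ContinuousOn.rpow_const (by fun_prop) ?_)
      exact fun x hx => Or.inl (by have := hx.2; intro h; linarith))
    (by
      intro t h0 h1
      rw [hν, withDensity_apply _ measurableSet_Ico, lintegral_one_sub_rpow hs hC h1]
      exact hμ t h0 h1)
  refine hle.trans ?_
  rw [hν, restrict_withDensity measurableSet_Ico,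
    lintegral_withDensity_eq_lintegral_mul _ hmd (by fun_prop)]
  have : ∫⁻ u in Ico (0:ℝ) 1, ((fun u : ℝ => ENNReal.ofReal (C * (s * (1 - u) ^ (s - 1)))) *
      fun t => ENNReal.ofReal (t ^ n * (1 - t) ^ (-q))) u =
      ∫⁻ u in Ico (0:ℝ) 1, ENNReal.ofReal (C * s) *
        ENNReal.ofReal (u ^ n * (1 - u) ^ (s - q - 1)) := by
    refine setLIntegral_congr_fun measurableSet_Ico fun u hu => ?_
    have h1 : 0 < 1 - u := by linarith [hu.2]
    simp only [Pi.mul_apply]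
    rw [← ENNReal.ofReal_mul (by positivity), ← ENNReal.ofReal_mul (by positivity)]
    congr 1
    have : (1 - u) ^ (s - q - 1) = (1 - u) ^ (s - 1) * (1 - u) ^ (-q) := by
      rw [← Real.rpow_add h1]; congr 1; ring
    rw [this]; ring
  rw [this, lintegral_const_mul' _ _ ENNReal.ofReal_ne_top, lintegral_pow_mul_one_sub_rpow n hb,
    ← ENNReal.ofReal_mul (by positivity)]
  refine ENNReal.ofReal_le_ofReal ?_
  rw [mul_assoc C s, mul_assoc C, mul_assoc s]
  refine mul_le_mul_of_nonneg_left (mul_le_mul_of_nonneg_left ?_ hs.le) hC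
  have h1 := (hcb n).1
  unfold hilbertWeight at h1
  rw [add_sub_cancel_right] at h1
  have hGn : 0 < Real.Gamma (n + (s - q + 1)) := Real.Gamma_pos_of_pos (by positivity)
  have hx : 0 < ((n:ℝ) + 1) ^ (s - q) := by positivity
  rw [ProbabilityTheory.beta, Real.Gamma_nat_eq_factorial,
    show (n:ℝ) + 1 + (s - q) = n + (s - q + 1) by ring, Real.rpow_neg (by positivity)]
  rw [le_div_iff₀ (by positivity)] at h1
  rw [div_le_iff₀ hGn]
  have e : Real.Gamma (s - q) / Real.Gamma (s - q + 1) / c * (((n:ℝ) + 1) ^ (s - q))⁻¹ *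
      Real.Gamma (n + (s - q + 1)) = (Real.Gamma (s - q) * Real.Gamma (n + (s - q + 1))) /
      (Real.Gamma (s - q + 1) * c * ((n:ℝ) + 1) ^ (s - q)) := by field_simp
  rw [e, le_div_iff₀ (by positivity)]
  nlinarith [mul_le_mul_of_nonneg_left h1 hG.le]

lemma log_norm_le_circleAverage {f : ℂ → ℂ} {c : ℂ} {R : ℝ} (hR : 0 < R)
    (hf : AnalyticOnNhd ℂ f (closedBall c R)) (hc : f c ≠ 0) :
    Real.log ‖f c‖ ≤ Real.circleAverage (fun z => Real.log ‖f z‖) c R := by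
  have hRR : |R| = R := abs_of_pos hR
  rw [AnalyticOnNhd.circleAverage_log_norm hR.ne' (by rwa [hRR]) hc, le_add_iff_nonneg_left]
  refine finsum_nonneg fun u => ?_
  by_cases hu : u ∈ closedBall c |R|
  · refine mul_nonneg (mod_cast MeromorphicOn.AnalyticOnNhd.divisor_nonneg (by rwa [hRR]) u) ?_
    by_cases huc : ‖c - u‖ = 0
    · simp [huc]
    · refine Real.log_nonneg ?_
      have : 0 < ‖c - u‖ := lt_of_le_of_ne (norm_nonneg _) (Ne.symm huc)
      rw [← div_eq_mul_inv, one_le_div this, norm_sub_rev, ← mem_closedBall_iff_norm, ← hRR]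
      exact hu
  · simp [Function.locallyFinsuppWithin.apply_eq_zero_of_notMem _ hu]

/-- Sub-mean value property of `|f|^p`. -/
lemma norm_rpow_le_circleAverage {f : ℂ → ℂ} {c : ℂ} {R p : ℝ} (hR : 0 < R) (hp : 0 < p)
    (hf : AnalyticOnNhd ℂ f (closedBall c R)) :
    ‖f c‖ ^ p ≤ Real.circleAverage (fun z => ‖f z‖ ^ p) c R := by
  have hRR : |R| = R := abs_of_pos hR
  by_cases hc : f c = 0
  · rw [hc, norm_zero, Real.zero_rpow hp.ne']
    exact Real.circleAverage_nonneg_of_nonneg fun z _ => by positivity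
  have hfc : 0 < ‖f c‖ := norm_pos_iff.2 hc
  set M : ℝ := Real.exp (1 / p) / ‖f c‖ with hM
  have hMpos : 0 < M := by positivity
  set g : ℂ → ℂ := fun z => M * f z with hg
  have hga : AnalyticOnNhd ℂ g (closedBall c R) := fun z hz => analyticAt_const.mul (hf z hz)
  have hng : ∀ z, ‖g z‖ = M * ‖f z‖ := fun z => by
    simp [hg, abs_of_pos hMpos]
  have hgc : ‖g c‖ = Real.exp (1 / p) := by rw [hng, hM]; field_simp
  have hgc0 : g c ≠ 0 := by rw [← norm_pos_iff, hgc]; positivity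
  have h1 := log_norm_le_circleAverage hR hga hgc0
  rw [hgc, Real.log_exp] at h1
  have hlog : ∀ x : ℝ, 0 ≤ x → Real.exp 1 * p * Real.log x ≤ x ^ p := by
    intro x hx
    rcases hx.eq_or_lt with rfl | hx
    · simp [Real.zero_rpow hp.ne']
    · have h2 := Real.log_le_sub_one_of_pos (x := x ^ p / Real.exp 1) (by positivity)
      rw [Real.log_div (by positivity) (by positivity), Real.log_exp, Real.log_rpow hx] at h2
      have h3 : p * Real.log x ≤ x ^ p / Real.exp 1 := by linarith
      rw [le_div_iff₀ (by positivity)] at h3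
      linarith
  have hcont : ContinuousOn (fun z => ‖g z‖ ^ p) (sphere c R) :=
    ((hga.continuousOn.mono sphere_subset_closedBall).norm).rpow_const fun _ _ => Or.inr hp.le
  have hI1 : CircleIntegrable (fun z => Real.log ‖g z‖) c R :=
    MeromorphicOn.circleIntegrable_log_norm fun z hz =>
      (hga z (sphere_subset_closedBall (by rwa [hRR] at hz))).meromorphicAt
  have hI2 : CircleIntegrable (fun z => ‖g z‖ ^ p) c R := hcont.circleIntegrable hR.le
  have h2 : Real.circleAverage (fun z => (Real.exp 1 * p) • Real.log ‖g z‖) c R ≤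
      Real.circleAverage (fun z => ‖g z‖ ^ p) c R :=
    Real.circleAverage_mono (hI1.const_smul) hI2 fun z _ => hlog _ (norm_nonneg _)
  rw [Real.circleAverage_fun_smul, smul_eq_mul] at h2
  have h3 : Real.exp 1 ≤ Real.circleAverage (fun z => ‖g z‖ ^ p) c R := by
    refine le_trans ?_ h2
    have := mul_le_mul_of_nonneg_left h1 (by positivity : 0 ≤ Real.exp 1 * p)
    refine le_trans (le_of_eq ?_) this
    field_simp
  have h4 : Real.circleAverage (fun z => ‖g z‖ ^ p) c R =
      M ^ p * Real.circleAverage (fun z => ‖f z‖ ^ p) c R := by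
    rw [← smul_eq_mul, ← Real.circleAverage_fun_smul]
    congr 1
    ext z
    rw [hng, Real.mul_rpow hMpos.le (norm_nonneg _), smul_eq_mul]
  have h5 : M ^ p * ‖f c‖ ^ p = Real.exp 1 := by
    rw [← Real.mul_rpow hMpos.le hfc.le, ← hng, hgc, ← Real.exp_mul]
    congr 1
    field_simp
  rw [h4, ← h5] at h3
  exact le_of_mul_le_mul_left h3 (by positivity)

/-- Polar coordinates centred at `c`. -/
lemma lintegral_eq_lintegral_circleMap {u : ℂ → ENNReal} (hu : Measurable u) (c : ℂ) :
    ∫⁻ w, u w = ∫⁻ r in Ioi (0:ℝ), ENNReal.ofReal r *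
      ∫⁻ θ in Ioo (-Real.pi) Real.pi, u (circleMap c r θ) := by
  have h1 : ∫⁻ w, u w = ∫⁻ w, u (c + w) := (lintegral_add_left_eq_self u c).symm
  have hm : Measurable fun q : ℝ × ℝ => u (circleMap c q.1 q.2) := by
    refine hu.comp ?_
    unfold circleMap
    fun_prop
  rw [h1, ← Complex.lintegral_comp_polarCoord_symm]
  have : polarCoord.target = Ioi (0:ℝ) ×ˢ Ioo (-Real.pi) Real.pi := rfl
  rw [this, Measure.volume_eq_prod, setLIntegral_prod]
  · refine lintegral_congr fun r => ?_
    rw [← lintegral_const_mul' _ _ ENNReal.ofReal_ne_top]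
    refine lintegral_congr fun θ => ?_
    rw [smul_eq_mul, Complex.polarCoord_symm_apply, circleMap, Complex.exp_mul_I]
    simp
  · refine Measurable.aemeasurable ?_
    have e : (fun q : ℝ × ℝ => ENNReal.ofReal q.1 • u (c + Complex.polarCoord.symm q)) =
        fun q : ℝ × ℝ => ENNReal.ofReal q.1 * u (circleMap c q.1 q.2) := by
      ext q
      rw [smul_eq_mul, Complex.polarCoord_symm_apply, circleMap, Complex.exp_mul_I]
      simp
    rw [e]
    exact (by fun_prop : Measurable fun q : ℝ × ℝ => ENNReal.ofReal q.1).mul hm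

lemma lintegral_circleMap_eq {g : ℂ → ℝ} {c : ℂ} {r : ℝ} (hr : 0 ≤ r)
    (hg : ContinuousOn g (sphere c r)) (hg0 : ∀ z, 0 ≤ g z) :
    ∫⁻ θ in Ioo (-Real.pi) Real.pi, ENNReal.ofReal (g (circleMap c r θ)) =
      ENNReal.ofReal (2 * Real.pi * Real.circleAverage g c r) := by
  have hc : Continuous fun θ => g (circleMap c r θ) :=
    hg.comp_continuous (continuous_circleMap c r) fun θ => circleMap_mem_sphere c hr θ
  have hper : Function.Periodic (fun θ => g (circleMap c r θ)) (2 * Real.pi) := fun θ => by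
    simp only [periodic_circleMap c r θ]
  have hpi := Real.pi_pos
  rw [← ofReal_integral_eq_lintegral_ofReal]
  · congr 1
    rw [← integral_Ioc_eq_integral_Ioo, ← intervalIntegral.integral_of_le (by linarith),
      Real.circleAverage, smul_eq_mul, mul_inv_cancel_left₀ (by positivity)]
    have := hper.intervalIntegral_add_eq (-Real.pi) 0
    rw [zero_add, show -Real.pi + 2 * Real.pi = Real.pi by ring] at this
    exact this
  · exact (hc.integrableOn_Icc (a := -Real.pi) (b := Real.pi)).mono_set Ioo_subset_Icc_self
  · exact Eventually.of_forall fun θ => hg0 _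

lemma hardyNorm_nonneg {p : ℝ} (f : ℂ → ℂ) : 0 ≤ hardyNorm p f := by
  refine Real.sSup_nonneg ?_
  rintro y ⟨r, -, -, rfl⟩
  refine Real.rpow_nonneg (mul_nonneg (by positivity) ?_) _
  exact intervalIntegral.integral_nonneg (by positivity) fun θ _ => by positivity

lemma circleAverage_norm_rpow_le {p : ℝ} (hp : 0 < p) {f : ℂ → ℂ} (hf : MemHp p f) {r : ℝ}
    (hr0 : 0 < r) (hr1 : r < 1) :
    Real.circleAverage (fun z => ‖f z‖ ^ p) 0 r ≤ hardyNorm p f ^ p := by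
  have hA : 0 ≤ Real.circleAverage (fun z => ‖f z‖ ^ p) 0 r :=
    Real.circleAverage_nonneg_of_nonneg fun z _ => by positivity
  have h1 : Real.circleAverage (fun z => ‖f z‖ ^ p) 0 r ^ (1 / p) ≤ hardyNorm p f := by
    refine le_csSup hf.2 ⟨r, hr0, hr1, ?_⟩
    simp [Real.circleAverage, circleMap]
  calc _ = (Real.circleAverage (fun z => ‖f z‖ ^ p) 0 r ^ (1 / p)) ^ p := by
        rw [← Real.rpow_mul hA, one_div_mul_cancel hp.ne', Real.rpow_one]
    _ ≤ _ := Real.rpow_le_rpow (by positivity) h1 hp.le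

/-- Growth of `H^p` functions. -/
lemma norm_le_hardyNorm {p : ℝ} (hp : 0 < p) {f : ℂ → ℂ} (hf : MemHp p f) {z : ℂ}
    (hz : ‖z‖ < 1) :
    ‖f z‖ ≤ 8 ^ (1 / p) * hardyNorm p f * (1 - ‖z‖) ^ (-(1 / p)) := by
  have hpi := Real.pi_pos
  set H := hardyNorm p f with hH
  have hH0 : 0 ≤ H := hardyNorm_nonneg f
  set δ : ℝ := (1 - ‖z‖) / 2 with hδ
  have hδ0 : 0 < δ := by rw [hδ]; linarith
  have hanal : AnalyticOnNhd ℂ f (ball 0 1) := hf.1.analyticOnNhd isOpen_ball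
  have hgc : ContinuousOn (fun w => ‖f w‖ ^ p) (ball 0 1) :=
    hf.1.continuousOn.norm.rpow_const fun _ _ => Or.inr hp.le
  have hsub : ball z δ ⊆ ball 0 1 := by
    intro w hw
    rw [mem_ball_iff_norm] at hw
    rw [mem_ball_zero_iff]
    have := norm_le_norm_add_norm_sub' w z
    rw [hδ] at hw
    linarith
  set u : ℂ → ENNReal := (ball z δ).indicator fun w => ENNReal.ofReal (‖f w‖ ^ p) with hu
  have hum : Measurable u := by
    classical
    have h1 : ContinuousOn (fun w => ENNReal.ofReal (‖f w‖ ^ p)) (ball z δ) :=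
      ENNReal.continuous_ofReal.comp_continuousOn (hgc.mono hsub)
    have h2 := h1.measurable_piecewise (g := (0 : ℂ → ENNReal)) continuousOn_const
      measurableSet_ball
    rwa [piecewise_eq_indicator] at h2
  have hlow : ENNReal.ofReal (δ ^ 2 / 2 * (2 * Real.pi * ‖f z‖ ^ p)) ≤ ∫⁻ w, u w := by
    rw [lintegral_eq_lintegral_circleMap hum z]
    calc ENNReal.ofReal (δ ^ 2 / 2 * (2 * Real.pi * ‖f z‖ ^ p))
        = ∫⁻ r in Ioo 0 δ, ENNReal.ofReal r * ENNReal.ofReal (2 * Real.pi * ‖f z‖ ^ p) := by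
          rw [lintegral_mul_const' _ _ ENNReal.ofReal_ne_top,
            ENNReal.ofReal_mul (by positivity), ← ofReal_integral_eq_lintegral_ofReal]
          · congr 2
            rw [← integral_Ioc_eq_integral_Ioo, ← intervalIntegral.integral_of_le hδ0.le,
              integral_id]
            ring
          · exact (continuous_id.integrableOn_Icc (a := (0:ℝ)) (b := δ)).mono_set
              Ioo_subset_Icc_self
          · exact (ae_restrict_iff' measurableSet_Ioo).2 (Eventually.of_forall fun r hr => hr.1.le)
      _ ≤ ∫⁻ r in Ioo 0 δ, ENNReal.ofReal r *
            ∫⁻ θ in Ioo (-Real.pi) Real.pi, u (circleMap z r θ) := by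
          refine setLIntegral_mono' measurableSet_Ioo fun r hr => ?_
          refine mul_le_mul_right ?_ _
          have hcb : closedBall z r ⊆ ball z δ := closedBall_subset_ball hr.2
          have e : ∀ θ, u (circleMap z r θ) = ENNReal.ofReal (‖f (circleMap z r θ)‖ ^ p) :=
            fun θ => indicator_of_mem (hcb (circleMap_mem_closedBall z hr.1.le θ)) _
          simp_rw [e]
          rw [lintegral_circleMap_eq (g := fun w => ‖f w‖ ^ p) hr.1.le
            (hgc.mono (sphere_subset_closedBall.trans (hcb.trans hsub))) fun _ => by positivity]
          refine ENNReal.ofReal_le_ofReal (mul_le_mul_of_nonneg_left ?_ (by positivity))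
          exact norm_rpow_le_circleAverage hr.1 hp (hanal.mono (hcb.trans hsub))
      _ ≤ _ := lintegral_mono_set Ioo_subset_Ioi_self
  have hup : ∫⁻ w, u w ≤ ENNReal.ofReal (2 * δ * (2 * Real.pi * H ^ p)) := by
    rw [lintegral_eq_lintegral_circleMap hum 0]
    calc _ ≤ ∫⁻ r in Ioi (0:ℝ), (Ioo (‖z‖ - δ) (‖z‖ + δ)).indicator
            (fun _ => ENNReal.ofReal (2 * Real.pi * H ^ p)) r := by
          refine setLIntegral_mono' measurableSet_Ioi fun r hr => ?_
          have hr0 : (0:ℝ) < r := hr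
          by_cases hmem : r ∈ Ioo (‖z‖ - δ) (‖z‖ + δ)
          · have hr1 : r < 1 := by have := hmem.2; rw [hδ] at this; linarith
            rw [indicator_of_mem hmem]
            calc _ ≤ ENNReal.ofReal 1 * ∫⁻ θ in Ioo (-Real.pi) Real.pi,
                  ENNReal.ofReal (‖f (circleMap 0 r θ)‖ ^ p) := by
                  refine mul_le_mul' (ENNReal.ofReal_le_ofReal hr1.le) ?_
                  exact lintegral_mono fun θ => indicator_le_self _ _ _
              _ ≤ _ := by
                  rw [lintegral_circleMap_eq (g := fun w => ‖f w‖ ^ p) hr0.le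
                    (hgc.mono (sphere_subset_ball hr1)) fun _ => by positivity]
                  simp only [ENNReal.ofReal_one, one_mul]
                  exact ENNReal.ofReal_le_ofReal (mul_le_mul_of_nonneg_left
                    (circleAverage_norm_rpow_le hp hf hr0 hr1) (by positivity))
          · have e : ∀ θ, u (circleMap 0 r θ) = 0 := by
              intro θ
              refine indicator_of_notMem (fun hw => hmem ?_) _
              have h1 : ‖circleMap 0 r θ‖ = r := by simp [abs_of_pos hr0]
              rw [mem_ball_iff_norm] at hw
              have h2 := abs_norm_sub_norm_le (circleMap 0 r θ) z
              rw [h1] at h2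
              have h3 := abs_lt.1 (h2.trans_lt hw)
              exact ⟨by linarith [h3.1], by linarith [h3.2]⟩
            simp [e]
      _ ≤ ∫⁻ r, (Ioo (‖z‖ - δ) (‖z‖ + δ)).indicator
            (fun _ => ENNReal.ofReal (2 * Real.pi * H ^ p)) r := setLIntegral_le_lintegral _ _
      _ = _ := by
          rw [lintegral_indicator_const measurableSet_Ioo, Real.volume_Ioo,
            ← ENNReal.ofReal_mul (by positivity)]
          congr 1
          ring
  have h := (ENNReal.ofReal_le_ofReal_iff (by positivity)).1 (hlow.trans hup)
  have hz1 : 0 < 1 - ‖z‖ := by linarith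
  have h2 : ‖f z‖ ^ p ≤ 8 * H ^ p * (1 - ‖z‖)⁻¹ := by
    have e : 1 - ‖z‖ = 2 * δ := by rw [hδ]; ring
    rw [e, ← div_eq_mul_inv, le_div_iff₀ (by positivity)]
    have h3 : (Real.pi * δ) * (‖f z‖ ^ p * (2 * δ)) ≤ (Real.pi * δ) * (8 * H ^ p) := by
      nlinarith [h]
    exact le_of_mul_le_mul_left h3 (by positivity)
  calc ‖f z‖ = (‖f z‖ ^ p) ^ (1 / p) := by
        rw [← Real.rpow_mul (norm_nonneg _), mul_one_div_cancel hp.ne', Real.rpow_one]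
    _ ≤ (8 * H ^ p * (1 - ‖z‖)⁻¹) ^ (1 / p) := Real.rpow_le_rpow (by positivity) h2 (by positivity)
    _ = _ := by
        rw [Real.mul_rpow (by positivity) (by positivity), Real.mul_rpow (by norm_num)
          (by positivity), ← Real.rpow_mul hH0, mul_one_div_cancel hp.ne', Real.rpow_one,
          Real.inv_rpow hz1.le, Real.rpow_neg hz1.le]

/-- The sum of the power series with coefficients `c`. -/
def powerSum (c : ℕ → ℂ) (z : ℂ) : ℂ := ∑' n : ℕ, c n * z ^ n

lemma summable_succ_pow_mul_geometric (d : ℕ) {ρ : ℝ} (h0 : 0 < ρ) (h1 : ρ < 1) :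
    Summable fun n : ℕ => ((n : ℝ) + 1) ^ d * ρ ^ n := by
  have h0' : Summable fun n : ℕ => (n : ℝ) ^ d * ρ ^ n :=
    summable_pow_mul_geometric_of_norm_lt_one d (by rwa [Real.norm_of_nonneg h0.le])
  have h : Summable fun n : ℕ => ((n + 1 : ℕ) : ℝ) ^ d * ρ ^ (n + 1) :=
    (summable_nat_add_iff (f := fun n : ℕ => (n : ℝ) ^ d * ρ ^ n) 1).2 h0'
  refine (h.mul_left ρ⁻¹).congr fun n => ?_
  rw [pow_succ ρ n, Nat.cast_add, Nat.cast_one]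
  field_simp

lemma summable_coeff_mul_pow {c : ℕ → ℂ} {K : ℝ} {d : ℕ}
    (hc : ∀ n, ‖c n‖ ≤ K * ((n : ℝ) + 1) ^ d) {z : ℂ} (hz : ‖z‖ < 1) :
    Summable fun n : ℕ => c n * z ^ n := by
  obtain ⟨ρ, hρ1, hρ2⟩ := exists_between hz
  have hρ0 : 0 < ρ := (norm_nonneg z).trans_lt hρ1
  refine Summable.of_norm_bounded ((summable_succ_pow_mul_geometric d hρ0 hρ2).mul_left K)
    fun n => ?_
  rw [norm_mul, norm_pow, ← mul_assoc]
  exact mul_le_mul (hc n) (pow_le_pow_left₀ (norm_nonneg z) hρ1.le n) (by positivity)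
    ((norm_nonneg _).trans (hc n))

lemma coeff_deriv_bound {c : ℕ → ℂ} {K : ℝ} {d : ℕ}
    (hc : ∀ n, ‖c n‖ ≤ K * ((n : ℝ) + 1) ^ d) (n : ℕ) :
    ‖((n : ℂ) + 1) * c (n + 1)‖ ≤ (K * 2 ^ d) * ((n : ℝ) + 1) ^ (d + 1) := by
  have hK : 0 ≤ K := by simpa using (norm_nonneg _).trans (hc 0)
  have e : ‖(n : ℂ) + 1‖ = (n : ℝ) + 1 := by
    rw [← Nat.cast_succ, Complex.norm_natCast, Nat.cast_succ]
  rw [norm_mul, e]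
  have h1 := hc (n + 1)
  push_cast at h1
  have h2 : ((n : ℝ) + 1 + 1) ^ d ≤ (2 * ((n : ℝ) + 1)) ^ d :=
    pow_le_pow_left₀ (by positivity) (by linarith [n.cast_nonneg (α := ℝ)]) d
  rw [mul_pow] at h2
  calc ((n : ℝ) + 1) * ‖c (n + 1)‖ ≤ ((n : ℝ) + 1) * (K * (2 ^ d * ((n : ℝ) + 1) ^ d)) :=
        mul_le_mul_of_nonneg_left (h1.trans (mul_le_mul_of_nonneg_left h2 hK)) (by positivity)
    _ = _ := by ring

lemma hasDerivAt_powerSum {c : ℕ → ℂ} {K : ℝ} {d : ℕ}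
    (hc : ∀ n, ‖c n‖ ≤ K * ((n : ℝ) + 1) ^ d) {z : ℂ} (hz : ‖z‖ < 1) :
    HasDerivAt (powerSum c) (powerSum (fun n => ((n : ℂ) + 1) * c (n + 1)) z) z := by
  obtain ⟨ρ, hρ1, hρ2⟩ := exists_between hz
  have hρ0 : 0 < ρ := (norm_nonneg z).trans_lt hρ1
  have hc' := coeff_deriv_bound hc
  set u : ℕ → ℝ := fun n => (n : ℝ) * ‖c n‖ * ρ ^ (n - 1) with hu
  have hus : Summable u := by
    rw [← summable_nat_add_iff 1]
    refine Summable.of_nonneg_of_le (fun n => by positivity) (fun n => ?_)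
      ((summable_succ_pow_mul_geometric (d + 1) hρ0 hρ2).mul_left (K * 2 ^ d))
    have e : ‖(n : ℂ) + 1‖ = (n : ℝ) + 1 := by
      rw [← Nat.cast_succ, Complex.norm_natCast, Nat.cast_succ]
    have := hc' n
    rw [norm_mul, e] at this
    simp only [hu, Nat.cast_add, Nat.cast_one, Nat.add_sub_cancel]
    rw [← mul_assoc]
    exact mul_le_mul_of_nonneg_right this (by positivity)
  have hd : HasDerivAt (powerSum c) (∑' n : ℕ, c n * ((n : ℂ) * z ^ (n - 1))) z := by
    refine hasDerivAt_tsum_of_isPreconnected (t := ball (0:ℂ) ρ) (u := u) (y₀ := 0)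
      (g := fun n z => c n * z ^ n) (g' := fun n z => c n * ((n : ℂ) * z ^ (n - 1))) hus isOpen_ball
      (convex_ball _ _).isPreconnected (fun n y _ => (hasDerivAt_pow n y).const_mul (c n))
      (fun n y hy => ?_) (mem_ball_self hρ0) ?_ (by simpa using hρ1)
    · rw [mem_ball_zero_iff] at hy
      rw [norm_mul, norm_mul, norm_pow, Complex.norm_natCast, ← mul_assoc, mul_comm ‖c n‖]
      exact mul_le_mul_of_nonneg_left (pow_le_pow_left₀ (norm_nonneg y) hy.le _) (by positivity)
    · exact summable_coeff_mul_pow hc (by simp)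
  convert hd using 1
  have hs : Summable fun n : ℕ => c n * ((n : ℂ) * z ^ (n - 1)) := by
    refine Summable.of_norm_bounded hus fun n => ?_
    rw [norm_mul, norm_mul, norm_pow, Complex.norm_natCast, ← mul_assoc, mul_comm ‖c n‖]
    exact mul_le_mul_of_nonneg_left (pow_le_pow_left₀ (norm_nonneg z) hρ1.le _) (by positivity)
  rw [hs.tsum_eq_zero_add, powerSum]
  simp only [Nat.cast_zero, zero_mul, mul_zero, zero_add, Nat.add_sub_cancel, Nat.cast_add,
    Nat.cast_one]
  exact tsum_congr fun n => by ring

lemma deriv_powerSum {c : ℕ → ℂ} {K : ℝ} {d : ℕ}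
    (hc : ∀ n, ‖c n‖ ≤ K * ((n : ℝ) + 1) ^ d) {z : ℂ} (hz : ‖z‖ < 1) :
    deriv (powerSum c) z = powerSum (fun n => ((n : ℂ) + 1) * c (n + 1)) z :=
  (hasDerivAt_powerSum hc hz).deriv

lemma norm_powerSum_le {c : ℕ → ℂ} {ε : ℝ} (hc : ∀ n, ‖c n‖ ≤ ε) {z : ℂ} (hz : ‖z‖ < 1) :
    ‖powerSum c z‖ ≤ ε * (1 - ‖z‖)⁻¹ := by
  refine tsum_of_norm_bounded ((hasSum_geometric_of_lt_one (norm_nonneg z) hz).mul_left ε)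
    fun n => ?_
  rw [norm_mul, norm_pow]
  exact mul_le_mul_of_nonneg_right (hc n) (by positivity)

lemma powerSum_zero (c : ℕ → ℂ) : powerSum c 0 = c 0 := by
  rw [powerSum, tsum_eq_single 0 (fun n hn => by simp [hn])]
  simp

/-- A power series with coefficients `O(1/n)` lies in the Bloch space. -/
lemma memBloch_of_coeff_le {c : ℕ → ℂ} {ε : ℝ} (hc : ∀ n : ℕ, ((n : ℝ) + 1) * ‖c n‖ ≤ ε)
    {h : ℂ → ℂ} (hh : EqOn h (powerSum c) (ball 0 1)) :
    MemBloch h ∧ blochNorm h ≤ 3 * ε := by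
  have hε : 0 ≤ ε := le_trans (by positivity) (hc 0)
  have hc1 : ∀ n, ‖c n‖ ≤ ε * ((n : ℝ) + 1) ^ 0 := fun n => by
    have h1 := hc n
    have h2 : 0 ≤ (n : ℝ) * ‖c n‖ := by positivity
    simp only [pow_zero, mul_one]
    linarith
  have hder : ∀ z : ℂ, ‖z‖ < 1 → HasDerivAt h (powerSum (fun n => ((n : ℂ) + 1) * c (n + 1)) z) z :=
    fun z hz => (hasDerivAt_powerSum hc1 hz).congr_of_eventuallyEq
      (hh.eventuallyEq_of_mem (isOpen_ball.mem_nhds (by simpa using hz)))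
  have hbd : ∀ y ∈ blochSet h, y ≤ 2 * ε := by
    rintro y ⟨z, hz, rfl⟩
    have hz0 := norm_nonneg z
    rw [(hder z hz).deriv]
    have h1 := norm_powerSum_le (c := fun n => ((n : ℂ) + 1) * c (n + 1)) (ε := ε) (fun n => by
      have h2 := hc (n + 1)
      have e : ‖(n : ℂ) + 1‖ = (n : ℝ) + 1 := by
        rw [← Nat.cast_succ, Complex.norm_natCast, Nat.cast_succ]
      rw [norm_mul, e]
      push_cast at h2
      nlinarith [norm_nonneg (c (n + 1))]) hz
    rw [← div_eq_mul_inv, le_div_iff₀ (by linarith)] at h1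
    set D := ‖powerSum (fun n => ((n : ℂ) + 1) * c (n + 1)) z‖ with hD
    have hD0 : 0 ≤ D := norm_nonneg _
    calc (1 - ‖z‖ ^ 2) * D = (1 + ‖z‖) * (D * (1 - ‖z‖)) := by ring
      _ ≤ 2 * ε := mul_le_mul (by linarith) h1 (by nlinarith) (by norm_num)
  refine ⟨⟨fun z hz => (hder z (by simpa using hz)).differentiableAt.differentiableWithinAt,
    2 * ε, hbd⟩, ?_⟩
  have h0 : ‖h 0‖ ≤ ε := by
    rw [hh (mem_ball_self one_pos), powerSum_zero]
    simpa using hc 0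
  have : sSup (blochSet h) ≤ 2 * ε := Real.sSup_le hbd (by positivity)
  unfold blochNorm
  linarith

lemma le_blochNorm {h : ℂ → ℂ} (hh : MemBloch h) {z : ℂ} (hz : ‖z‖ < 1) :
    (1 - ‖z‖ ^ 2) * ‖deriv h z‖ ≤ blochNorm h :=
  (le_csSup hh.2 ⟨z, hz, rfl⟩).trans (le_add_of_nonneg_left (norm_nonneg _))

lemma MemBloch.sub {f g : ℂ → ℂ} (hf : MemBloch f) (hg : MemBloch g) :
    MemBloch fun z => f z - g z := by
  refine ⟨hf.1.sub hg.1, blochNorm f + blochNorm g, ?_⟩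
  rintro y ⟨z, hz, rfl⟩
  have hb : ball (0:ℂ) 1 ∈ 𝓝 z := isOpen_ball.mem_nhds (by simpa using hz)
  rw [deriv_fun_sub (hf.1.differentiableAt hb) (hg.1.differentiableAt hb)]
  have h1 := le_blochNorm hf hz
  have h2 := le_blochNorm hg hz
  have h3 := norm_sub_le (deriv f z) (deriv g z)
  have h4 : 0 ≤ 1 - ‖z‖ ^ 2 := by nlinarith [norm_nonneg z]
  nlinarith [mul_le_mul_of_nonneg_left h3 h4]

/-- The Taylor coefficients of `𝓗_{μ,α} f`. -/
def hopCoeff (μ : Measure ℝ) (α : ℝ) (f : ℂ → ℂ) (n : ℕ) : ℂ :=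
  ∑' k : ℕ, (muCoef μ α n k : ℂ) * taylorCoeff f k

lemma Hop_eq_powerSum (μ : Measure ℝ) (α : ℝ) (f : ℂ → ℂ) :
    Hop μ α f = powerSum (hopCoeff μ α f) := rfl

lemma hasSum_taylorCoeff {f : ℂ → ℂ} (hf : DifferentiableOn ℂ f (ball 0 1)) {z : ℂ}
    (hz : ‖z‖ < 1) : HasSum (fun k : ℕ => taylorCoeff f k * z ^ k) (f z) := by
  have := Complex.hasSum_taylorSeries_on_ball hf (by simpa using hz : z ∈ ball 0 1)
  have e : (fun k : ℕ => taylorCoeff f k * z ^ k) =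
      fun k : ℕ => (k.factorial : ℂ)⁻¹ • (z - 0) ^ k • iteratedDeriv k f 0 := by
    ext k
    simp only [taylorCoeff, sub_zero, smul_eq_mul]
    ring
  rwa [e]

lemma integrableOn_pow (μ : Measure ℝ) [IsFiniteMeasure (μ.restrict (Ico 0 1))] (n : ℕ) :
    IntegrableOn (fun t : ℝ => t ^ n) (Ico 0 1) μ := by
  refine Integrable.of_bound (by fun_prop) 1 ?_
  refine (ae_restrict_iff' measurableSet_Ico).2 (Eventually.of_forall fun t ht => ?_)
  rw [Real.norm_of_nonneg (pow_nonneg ht.1 n)]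
  exact pow_le_one₀ ht.1 ht.2.le

/-- Integral representation of the coefficients of `𝓗_{μ,α} f`. -/
lemma hopCoeff_eq_integral {μ : Measure ℝ} [IsFiniteMeasure (μ.restrict (Ico 0 1))] {α : ℝ}
    {f : ℂ → ℂ} (hf : DifferentiableOn ℂ f (ball 0 1))
    (hs : Summable fun k : ℕ => ‖taylorCoeff f k‖ * ∫ t in Ico (0:ℝ) 1, t ^ k ∂μ) (n : ℕ) :
    hopCoeff μ α f n = hilbertWeight α n * ∫ t in Ico (0:ℝ) 1, (t : ℂ) ^ n * f t ∂μ := by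
  set F : ℕ → ℝ → ℂ := fun k t => ((t ^ (n + k) : ℝ) : ℂ) * taylorCoeff f k with hF
  have hFi : ∀ k, Integrable (F k) (μ.restrict (Ico 0 1)) := fun k =>
    (integrableOn_pow μ (n + k)).ofReal.mul_const _
  have hFn : ∀ k, ∫ t in Ico (0:ℝ) 1, ‖F k t‖ ∂μ ≤
      ‖taylorCoeff f k‖ * ∫ t in Ico (0:ℝ) 1, t ^ k ∂μ := by
    intro k
    rw [← integral_const_mul]
    refine setIntegral_mono_on (hFi k).norm ((integrableOn_pow μ k).const_mul _)
      measurableSet_Ico fun t ht => ?_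
    have h0 : 0 ≤ t ^ (n + k) := pow_nonneg ht.1 _
    rw [hF, norm_mul, Complex.norm_real, Real.norm_of_nonneg h0, mul_comm]
    exact mul_le_mul_of_nonneg_left (pow_le_pow_of_le_one ht.1 ht.2.le (by omega)) (norm_nonneg _)
  have h := hasSum_integral_of_summable_integral_norm hFi
    (Summable.of_nonneg_of_le (fun k => by positivity) hFn hs)
  have e1 : ∫ t in Ico (0:ℝ) 1, ∑' k, F k t ∂μ = ∫ t in Ico (0:ℝ) 1, (t : ℂ) ^ n * f t ∂μ := by
    refine setIntegral_congr_fun measurableSet_Ico fun t ht => ?_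
    have ht1 : ‖(t : ℂ)‖ < 1 := by
      rw [Complex.norm_real, Real.norm_of_nonneg ht.1]; exact ht.2
    have := (hasSum_taylorCoeff hf ht1).mul_left ((t : ℂ) ^ n)
    rw [← this.tsum_eq]
    refine tsum_congr fun k => ?_
    simp only [hF]
    push_cast
    ring
  rw [e1] at h
  rw [hopCoeff, ← (h.mul_left (hilbertWeight α n : ℂ)).tsum_eq]
  refine tsum_congr fun k => ?_
  simp only [hF]
  rw [integral_mul_const, integral_complex_ofReal, ← mul_assoc, muCoef, hilbertWeight]
  push_cast
  ring

lemma norm_hopCoeff_le {μ : Measure ℝ} [IsFiniteMeasure (μ.restrict (Ico 0 1))] {α : ℝ}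
    (hα : 0 < α) {f : ℂ → ℂ} (hf : DifferentiableOn ℂ f (ball 0 1))
    (hs : Summable fun k : ℕ => ‖taylorCoeff f k‖ * ∫ t in Ico (0:ℝ) 1, t ^ k ∂μ) (n : ℕ) :
    ‖hopCoeff μ α f n‖ ≤ hilbertWeight α n * ∫ t in Ico (0:ℝ) 1, t ^ n * ‖f t‖ ∂μ := by
  rw [hopCoeff_eq_integral hf hs, norm_mul, Complex.norm_real,
    Real.norm_of_nonneg (hilbertWeight_pos hα n).le]
  refine mul_le_mul_of_nonneg_left ((norm_integral_le_integral_norm _).trans (le_of_eq ?_))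
    (hilbertWeight_pos hα n).le
  refine setIntegral_congr_fun measurableSet_Ico fun t ht => ?_
  simp [abs_of_nonneg ht.1]

lemma CondT1.measure_lt_top {p : ℝ} {μ : Measure ℝ} (h : CondT1 p μ) : μ (Ico 0 1) < ⊤ := by
  rcases le_or_gt p 1 with hp | hp
  · obtain ⟨C, -, hC⟩ := h.1 hp
    exact (hC 0 le_rfl one_pos).trans_lt ENNReal.ofReal_lt_top
  · obtain ⟨C, -, hC⟩ := h.2 hp
    exact (hC 0 le_rfl one_pos).trans_lt ENNReal.ofReal_lt_top

lemma IsVanishingCarleson.exists_tail_le {μ : Measure ℝ} {s : ℝ} (h : IsVanishingCarleson μ s)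
    {ε : ℝ} (hε : 0 < ε) : ∃ b : ℝ, 0 < b ∧ b < 1 ∧ ∀ t : ℝ, b ≤ t → t < 1 →
      μ (Ico t 1) ≤ ENNReal.ofReal (ε * (1 - t) ^ s) := by
  have h1 := h.eventually_le_const (ENNReal.ofReal_pos.2 hε)
  obtain ⟨b, hb1, hb⟩ := (mem_nhdsLT_iff_exists_Ioo_subset).1 h1
  have hb1' : b < 1 := hb1
  refine ⟨max (1 / 2) ((b + 1) / 2), by positivity, max_lt (by norm_num) (by linarith),
    fun t ht ht1 => ?_⟩
  have hbt : b < t := by linarith [(le_max_right _ _).trans ht]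
  have h2 : μ (Ico t 1) / ENNReal.ofReal ((1 - t) ^ s) ≤ ENNReal.ofReal ε := hb ⟨hbt, ht1⟩
  have hpos : 0 < (1 - t) ^ s := Real.rpow_pos_of_pos (by linarith) s
  rwa [ENNReal.div_le_iff (ENNReal.ofReal_pos.2 hpos).ne' ENNReal.ofReal_ne_top,
    ← ENNReal.ofReal_mul hε.le] at h2

lemma isCarleson_of_tail_le {μ : Measure ℝ} {s b C : ℝ} (hs : 0 ≤ s) (hfin : μ (Ico 0 1) < ⊤)
    (hb1 : b < 1) (hC : 0 < C)
    (h : ∀ t : ℝ, b ≤ t → t < 1 → μ (Ico t 1) ≤ ENNReal.ofReal (C * (1 - t) ^ s)) :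
    IsCarleson μ s := by
  set M := (μ (Ico 0 1)).toReal
  have hb : 0 < (1 - b) ^ s := Real.rpow_pos_of_pos (by linarith) s
  refine ⟨C + M * ((1 - b) ^ s)⁻¹, by positivity, fun t h0 h1 => ?_⟩
  have ht : 0 < (1 - t) ^ s := Real.rpow_pos_of_pos (by linarith) s
  rcases le_or_gt b t with hbt | hbt
  · refine (h t hbt h1).trans (ENNReal.ofReal_le_ofReal ?_)
    exact mul_le_mul_of_nonneg_right (le_add_of_nonneg_right (by positivity)) ht.le
  · calc μ (Ico t 1) ≤ μ (Ico 0 1) := measure_mono (Ico_subset_Ico_left h0)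
      _ = ENNReal.ofReal M := (ENNReal.ofReal_toReal hfin.ne).symm
      _ ≤ _ := by
        refine ENNReal.ofReal_le_ofReal ?_
        have h3 : (1 - b) ^ s ≤ (1 - t) ^ s := Real.rpow_le_rpow (by linarith) (by linarith) hs
        have h4 : M ≤ M * ((1 - b) ^ s)⁻¹ * (1 - t) ^ s := by
          rw [mul_assoc]
          refine le_mul_of_one_le_right ENNReal.toReal_nonneg ?_
          rwa [← div_eq_inv_mul, one_le_div hb]
        have h5 : 0 < C * (1 - t) ^ s := by positivity
        linarith

lemma IsVanishingCarleson.isCarleson {μ : Measure ℝ} {s : ℝ} (h : IsVanishingCarleson μ s)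
    (hs : 0 ≤ s) (hfin : μ (Ico 0 1) < ⊤) : IsCarleson μ s := by
  obtain ⟨b, -, hb1, hb⟩ := h.exists_tail_le one_pos
  exact isCarleson_of_tail_le hs hfin hb1 one_pos hb

/-- The moments `∫ t^n (1-t)^(-q) dμ`. -/
def singularMoment (μ : Measure ℝ) (q : ℝ) (n : ℕ) : ENNReal :=
  ∫⁻ t in Ico 0 1, ENNReal.ofReal (t ^ n * (1 - t) ^ (-q)) ∂μ

lemma IsCarleson.exists_singularMoment_le {μ : Measure ℝ} {s q : ℝ} (h : IsCarleson μ s)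
    (hq : 0 ≤ q) (hqs : q < s) : ∃ K : ℝ, 0 < K ∧ ∀ n : ℕ,
      singularMoment μ q n ≤ ENNReal.ofReal (K * ((n : ℝ) + 1) ^ (-(s - q))) := by
  obtain ⟨K, hK, h1⟩ := exists_lintegral_pow_mul_le hq hqs
  obtain ⟨C, hC, h2⟩ := h
  exact ⟨C * K, by positivity, h1 μ C hC.le h2⟩

lemma ae_nonneg_pow_mul_rpow (μ : Measure ℝ) (q : ℝ) (n : ℕ) :
    0 ≤ᵐ[μ.restrict (Ico 0 1)] fun t : ℝ => t ^ n * (1 - t) ^ (-q) :=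
  (ae_restrict_iff' measurableSet_Ico).2 (Eventually.of_forall fun t ht =>
    mul_nonneg (pow_nonneg ht.1 n) (Real.rpow_nonneg (by linarith [ht.2]) _))

lemma integrableOn_of_singularMoment_ne_top {μ : Measure ℝ} {q : ℝ} {n : ℕ}
    (h : singularMoment μ q n ≠ ⊤) :
    IntegrableOn (fun t : ℝ => t ^ n * (1 - t) ^ (-q)) (Ico 0 1) μ := by
  refine ⟨by fun_prop, ?_⟩
  rw [hasFiniteIntegral_iff_ofReal (ae_nonneg_pow_mul_rpow μ q n)]
  exact lt_top_iff_ne_top.2 h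

lemma integral_eq_singularMoment (μ : Measure ℝ) (q : ℝ) (n : ℕ) :
    ∫ t in Ico (0:ℝ) 1, t ^ n * (1 - t) ^ (-q) ∂μ = (singularMoment μ q n).toReal :=
  integral_eq_lintegral_of_nonneg_ae (ae_nonneg_pow_mul_rpow μ q n) (by fun_prop)

lemma tendsto_rpow_mul_geometric (a : ℝ) {b : ℝ} (hb0 : 0 < b) (hb1 : b < 1) :
    Tendsto (fun n : ℕ => ((n : ℝ) + 1) ^ a * b ^ n) atTop (𝓝 0) := by
  have h := (summable_succ_pow_mul_geometric ⌈a⌉₊ hb0 hb1).tendsto_atTop_zero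
  refine squeeze_zero (fun n => by positivity) (fun n => ?_) h
  refine mul_le_mul_of_nonneg_right ?_ (by positivity)
  rw [← Real.rpow_natCast]
  exact Real.rpow_le_rpow_of_exponent_le (by linarith [n.cast_nonneg (α := ℝ)]) (Nat.le_ceil a)

lemma IsVanishingCarleson.tendsto_singularMoment {μ : Measure ℝ} {s q : ℝ}
    (h : IsVanishingCarleson μ s) (hfin : μ (Ico 0 1) < ⊤) (hq : 0 ≤ q) (hqs : q < s) :
    Tendsto (fun n : ℕ => ((n : ℝ) + 1) ^ (s - q) * (singularMoment μ q n).toReal)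
      atTop (𝓝 0) := by
  obtain ⟨K, hK, hA⟩ := exists_lintegral_pow_mul_le hq hqs
  rw [Metric.tendsto_atTop']
  intro ε hε
  obtain ⟨b, hb0, hb1, hb⟩ := h.exists_tail_le (ε := ε / (2 * K)) (by positivity)
  set M := (μ (Ico 0 1)).toReal
  have h1b : 0 < 1 - b := by linarith
  have hbound : ∀ n : ℕ, ((n : ℝ) + 1) ^ (s - q) * (singularMoment μ q n).toReal ≤
      ((n : ℝ) + 1) ^ (s - q) * b ^ n * ((1 - b) ^ (-q) * M) + ε / 2 := by
    intro n
    have h1 : ∫⁻ t in Ico 0 b, ENNReal.ofReal (t ^ n * (1 - t) ^ (-q)) ∂μ ≤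
        ENNReal.ofReal (b ^ n * (1 - b) ^ (-q) * M) := by
      calc _ ≤ ∫⁻ t in Ico 0 b, ENNReal.ofReal (b ^ n * (1 - b) ^ (-q)) ∂μ := by
            refine setLIntegral_mono' measurableSet_Ico fun t ht => ENNReal.ofReal_le_ofReal ?_
            exact mul_le_mul (pow_le_pow_left₀ ht.1 ht.2.le n)
              (Real.rpow_le_rpow_of_nonpos h1b (by linarith [ht.2]) (by linarith))
              (Real.rpow_nonneg (by linarith [ht.2]) _) (by positivity)
        _ ≤ ENNReal.ofReal (b ^ n * (1 - b) ^ (-q)) * μ (Ico 0 1) := by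
            rw [setLIntegral_const]
            exact mul_le_mul_right (measure_mono (Ico_subset_Ico_right hb1.le)) _
        _ = _ := by
            rw [ENNReal.ofReal_mul (p := b ^ n * (1 - b) ^ (-q)) (by positivity),
              (ENNReal.ofReal_toReal hfin.ne : ENNReal.ofReal M = _)]
    have h2 := hA (μ.restrict (Ico b 1)) (ε / (2 * K)) (by positivity) (fun t ht0 ht1 => by
      rw [Measure.restrict_apply measurableSet_Ico, Ico_inter_Ico, min_self]
      refine (hb _ (le_max_right _ _) (max_lt ht1 hb1)).trans (ENNReal.ofReal_le_ofReal ?_)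
      refine mul_le_mul_of_nonneg_left ?_ (by positivity)
      exact Real.rpow_le_rpow (by linarith [max_lt ht1 hb1]) (by linarith [le_max_left t b])
        (hq.trans hqs.le)) n
    rw [Measure.restrict_restrict measurableSet_Ico, Ico_inter_Ico, max_eq_right hb0.le,
      min_self] at h2
    have h3 : singularMoment μ q n ≤ ENNReal.ofReal (b ^ n * (1 - b) ^ (-q) * M +
        ε / (2 * K) * K * ((n : ℝ) + 1) ^ (-(s - q))) := by
      rw [ENNReal.ofReal_add (by positivity) (by positivity), singularMoment,
        ← Ico_union_Ico_eq_Ico hb0.le hb1.le]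
      exact (lintegral_union_le _ _ _).trans (add_le_add h1 h2)
    have h4 := ENNReal.toReal_le_of_le_ofReal (by positivity) h3
    have h5 := mul_le_mul_of_nonneg_left h4 (by positivity : 0 ≤ ((n : ℝ) + 1) ^ (s - q))
    refine h5.trans (le_of_eq ?_)
    have h6 : ((n : ℝ) + 1) ^ (s - q) * ((n : ℝ) + 1) ^ (-(s - q)) = 1 := by
      rw [← Real.rpow_add (by positivity), add_neg_cancel, Real.rpow_zero]
    have h7 : ε / (2 * K) * K = ε / 2 := by field_simp
    rw [h7, mul_add, mul_left_comm _ (ε / 2), h6]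
    ring
  have ht := (tendsto_rpow_mul_geometric (s - q) hb0 hb1).mul_const ((1 - b) ^ (-q) * M)
  rw [zero_mul] at ht
  obtain ⟨N, hN⟩ := eventually_atTop.1 (ht.eventually_lt_const (by positivity : 0 < ε / 2))
  refine ⟨N, fun n hn => ?_⟩
  rw [Real.dist_eq, sub_zero, abs_of_nonneg (by positivity)]
  linarith [hbound n, hN n hn.le]

/-- Taylor coefficients of `H^p` functions. -/
lemma norm_taylorCoeff_le {p : ℝ} (hp : 0 < p) {f : ℂ → ℂ} (hf : MemHp p f) (k : ℕ) :
    ‖taylorCoeff f k‖ ≤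
      8 ^ (1 / p) * hardyNorm p f * 2 ^ (1 / p) * Real.exp 1 * ((k : ℝ) + 1) ^ (1 / p) := by
  have hH := hardyNorm_nonneg (p := p) f
  set R : ℝ := (k + 1) / (k + 2) with hR
  have hR0 : 0 < R := by positivity
  have hR1 : R < 1 := by rw [hR, div_lt_one (by positivity)]; linarith
  have h1R : 1 - R = ((k : ℝ) + 2)⁻¹ := by rw [hR]; field_simp; ring
  have hd : DiffContOnCl ℂ f (ball 0 R) :=
    (hf.1.mono (closedBall_subset_ball hR1)).diffContOnCl_ball subset_rfl
  have h1 := Complex.norm_iteratedDeriv_le_of_forall_mem_sphere_norm_le (f := f) (c := 0)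
    (C := 8 ^ (1 / p) * hardyNorm p f * ((k : ℝ) + 2) ^ (1 / p)) k hR0 hd (fun z hz => by
      have hz' : ‖z‖ = R := by simpa using hz
      have := norm_le_hardyNorm hp hf (z := z) (by rw [hz']; exact hR1)
      rwa [hz', h1R, Real.inv_rpow (by positivity), Real.rpow_neg (by positivity), inv_inv] at this)
  have hRk : (R ^ k)⁻¹ ≤ Real.exp 1 := by
    have e : R⁻¹ = 1 + 1 / ((k : ℝ) + 1) := by rw [hR]; field_simp; ring
    rw [← inv_pow, e]
    calc (1 + 1 / ((k : ℝ) + 1)) ^ k ≤ Real.exp (1 / ((k : ℝ) + 1)) ^ k :=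
          pow_le_pow_left₀ (by positivity) (by linarith [Real.add_one_le_exp (1 / ((k : ℝ) + 1))]) k
      _ = Real.exp (k * (1 / ((k : ℝ) + 1))) := by rw [← Real.exp_nat_mul]
      _ ≤ Real.exp 1 := by
          refine Real.exp_le_exp.2 ?_
          rw [mul_one_div, div_le_one (by positivity)]
          linarith
  have hk2 : ((k : ℝ) + 2) ^ (1 / p) ≤ 2 ^ (1 / p) * ((k : ℝ) + 1) ^ (1 / p) := by
    rw [← Real.mul_rpow (by norm_num) (by positivity)]
    exact Real.rpow_le_rpow (by positivity) (by linarith [k.cast_nonneg (α := ℝ)]) (by positivity)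
  have hkf : (0 : ℝ) < k.factorial := by exact_mod_cast k.factorial_pos
  rw [taylorCoeff, norm_div, Complex.norm_natCast, div_le_iff₀ hkf]
  refine h1.trans ?_
  calc _ = (8 ^ (1 / p) * hardyNorm p f * (((k : ℝ) + 2) ^ (1 / p) * (R ^ k)⁻¹)) *
        k.factorial := by rw [div_eq_mul_inv]; ring
    _ ≤ (8 ^ (1 / p) * hardyNorm p f * ((2 ^ (1 / p) * ((k : ℝ) + 1) ^ (1 / p)) * Real.exp 1)) *
        k.factorial := by gcongr
    _ = _ := by ring

lemma summable_taylorCoeff_mul_moment {p α : ℝ} (hp : 0 < p) (hα : 1 < α) {μ : Measure ℝ}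
    (hμ : IsCarleson μ (1 / p + α)) {f : ℂ → ℂ} (hf : MemHp p f) :
    Summable fun k : ℕ => ‖taylorCoeff f k‖ * ∫ t in Ico (0:ℝ) 1, t ^ k ∂μ := by
  have hp' : 0 < 1 / p := by positivity
  have hH := hardyNorm_nonneg (p := p) f
  obtain ⟨K, hK, hm⟩ := hμ.exists_singularMoment_le le_rfl (by linarith)
  set A := 8 ^ (1 / p) * hardyNorm p f * 2 ^ (1 / p) * Real.exp 1 with hA
  have hs : Summable fun k : ℕ => A * K * ((k : ℝ) + 1) ^ (-α) := by
    have h1 : Summable fun k : ℕ => (k : ℝ) ^ (-α) := Real.summable_nat_rpow.2 (by linarith)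
    have h2 := (summable_nat_add_iff (f := fun k : ℕ => (k : ℝ) ^ (-α)) 1).2 h1
    simp only [Nat.cast_add, Nat.cast_one] at h2
    exact h2.mul_left _
  have hint : ∀ k : ℕ, 0 ≤ ∫ t in Ico (0:ℝ) 1, t ^ k ∂μ := fun k =>
    setIntegral_nonneg measurableSet_Ico fun t ht => pow_nonneg ht.1 k
  refine Summable.of_nonneg_of_le (fun k => mul_nonneg (norm_nonneg _) (hint k)) (fun k => ?_) hs
  have h1 : ∫ t in Ico (0:ℝ) 1, t ^ k ∂μ ≤ K * ((k : ℝ) + 1) ^ (-(1 / p + α)) := by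
    have e := integral_eq_singularMoment μ 0 k
    simp only [neg_zero, Real.rpow_zero, mul_one] at e
    rw [e]
    refine ENNReal.toReal_le_of_le_ofReal (by positivity) ?_
    simpa using hm k
  calc _ ≤ A * ((k : ℝ) + 1) ^ (1 / p) * (K * ((k : ℝ) + 1) ^ (-(1 / p + α))) :=
        mul_le_mul (norm_taylorCoeff_le hp hf k) h1 (hint k) (by positivity)
    _ = A * K * (((k : ℝ) + 1) ^ (1 / p) * ((k : ℝ) + 1) ^ (-(1 / p + α))) := by ring
    _ = _ := by rw [← Real.rpow_add (by positivity)]; congr 2; ring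

/-- The coefficients of `𝓗_{μ,α} f` are controlled by singular moments of `μ`. -/
lemma exists_norm_hopCoeff_le {p α : ℝ} (hp : 0 < p) (hα : 1 < α) :
    ∃ B : ℝ, 0 < B ∧ ∀ μ : Measure ℝ, μ (Ico 0 1) < ⊤ → IsCarleson μ (1 / p + α) →
      ∀ f : ℂ → ℂ, MemHp p f → ∀ n : ℕ, ((n : ℝ) + 1) * ‖hopCoeff μ α f n‖ ≤
        B * (((n : ℝ) + 1) ^ α * (singularMoment μ (1 / p) n).toReal) * hardyNorm p f := by
  obtain ⟨_, C, _, hC, hw⟩ := exists_hilbertWeight_bounds (α := α) (by linarith)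
  refine ⟨C * 8 ^ (1 / p), by positivity, fun μ hfin hμ f hf n => ?_⟩
  have hH := hardyNorm_nonneg (p := p) f
  have hp' : 0 < 1 / p := by positivity
  have : IsFiniteMeasure (μ.restrict (Ico 0 1)) := ⟨by simpa using hfin⟩
  obtain ⟨K, -, hm⟩ := hμ.exists_singularMoment_le hp'.le (by linarith)
  have hne : singularMoment μ (1 / p) n ≠ ⊤ := ((hm n).trans_lt ENNReal.ofReal_lt_top).ne
  set T := (singularMoment μ (1 / p) n).toReal
  have hT : 0 ≤ T := ENNReal.toReal_nonneg
  have h1 := norm_hopCoeff_le (μ := μ) (α := α) (by linarith) hf.1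
    (summable_taylorCoeff_mul_moment hp hα hμ hf) n
  have h2 : ∫ t in Ico (0:ℝ) 1, t ^ n * ‖f t‖ ∂μ ≤ 8 ^ (1 / p) * hardyNorm p f * T := by
    rw [show T = _ from (integral_eq_singularMoment μ (1 / p) n).symm, ← integral_const_mul]
    refine integral_mono_of_nonneg ?_ ((integrableOn_of_singularMoment_ne_top hne).const_mul _) ?_
    · exact (ae_restrict_iff' measurableSet_Ico).2 (Eventually.of_forall fun t ht =>
        mul_nonneg (pow_nonneg ht.1 n) (norm_nonneg _))
    · refine (ae_restrict_iff' measurableSet_Ico).2 (Eventually.of_forall fun t ht => ?_)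
      have ht1 : ‖(t : ℂ)‖ = t := by rw [Complex.norm_real, Real.norm_of_nonneg ht.1]
      have h3 := norm_le_hardyNorm hp hf (z := t) (by rw [ht1]; exact ht.2)
      rw [ht1] at h3
      have h4 := mul_le_mul_of_nonneg_left h3 (pow_nonneg ht.1 n)
      simp only
      linarith
  have hx : (0 : ℝ) < (n : ℝ) + 1 := by positivity
  calc ((n : ℝ) + 1) * ‖hopCoeff μ α f n‖
      ≤ ((n : ℝ) + 1) * ((C * ((n : ℝ) + 1) ^ (α - 1)) * (8 ^ (1 / p) * hardyNorm p f * T)) := by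
        refine mul_le_mul_of_nonneg_left (h1.trans ?_) hx.le
        refine mul_le_mul (hw n).2 h2 ?_ (by positivity)
        exact setIntegral_nonneg measurableSet_Ico fun t ht =>
          mul_nonneg (pow_nonneg ht.1 n) (norm_nonneg _)
    _ = _ := by rw [Real.rpow_sub_one hx.ne']; field_simp

lemma IsVanishingCarleson.compactHpToBloch {p α : ℝ} (hp : 0 < p) (hα : 1 < α) {μ : Measure ℝ}
    (hfin : μ (Ico 0 1) < ⊤) (h : IsVanishingCarleson μ (1 / p + α)) :
    CompactHpToBloch μ α p := by
  have hp' : 0 < 1 / p := by positivity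
  have hcar := h.isCarleson (by linarith) hfin
  obtain ⟨B, hB, hcoef⟩ := exists_norm_hopCoeff_le hp hα
  set e : ℕ → ℝ := fun n => B * (((n : ℝ) + 1) ^ α * (singularMoment μ (1 / p) n).toReal) with he
  have he0 : ∀ n, 0 ≤ e n := fun n => by positivity
  have het : Tendsto e atTop (𝓝 0) := by
    have h1 := h.tendsto_singularMoment hfin hp'.le (by linarith : 1 / p < 1 / p + α)
    rw [add_sub_cancel_left] at h1
    have h2 := h1.const_mul B
    rwa [mul_zero] at h2
  have hc : ∀ f, MemHp p f → ∀ n : ℕ, ((n : ℝ) + 1) * ‖hopCoeff μ α f n‖ ≤ e n * hardyNorm p f :=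
    hcoef μ hfin hcar
  obtain ⟨E, hE⟩ := het.bddAbove_range
  have hE' : ∀ n, e n ≤ E := fun n => hE (mem_range_self n)
  have hE0 : 0 ≤ E := (he0 0).trans (hE' 0)
  have hb : ∀ f, MemHp p f → MemBloch (Hop μ α f) ∧
      blochNorm (Hop μ α f) ≤ 3 * (E * hardyNorm p f) := fun f hf =>
    memBloch_of_coeff_le (fun n => (hc f hf n).trans
      (mul_le_mul_of_nonneg_right (hE' n) (hardyNorm_nonneg f)))
      (by rw [Hop_eq_powerSum]; exact eqOn_refl _ _)
  refine ⟨⟨fun f hf => (hb f hf).1, 3 * E + 1, by positivity, fun f hf => ?_⟩, ?_⟩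
  · nlinarith [(hb f hf).2, hardyNorm_nonneg (p := p) f]
  intro F hF ⟨M, hM⟩
  have hM0 : 0 ≤ M := (hardyNorm_nonneg _).trans (hM 0)
  set x : ℕ → ℕ → ℂ := fun j n => ((n : ℂ) + 1) * hopCoeff μ α (F j) n with hx
  have hn1 : ∀ n : ℕ, ‖(n : ℂ) + 1‖ = (n : ℝ) + 1 := fun n => by
    rw [← Nat.cast_succ, Complex.norm_natCast, Nat.cast_succ]
  have hxb : ∀ j n, ‖x j n‖ ≤ e n * M := fun j n => by
    rw [hx, norm_mul, hn1]
    exact (hc _ (hF j) n).trans (mul_le_mul_of_nonneg_left (hM j) (he0 n))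
  obtain ⟨y, hy, φ, hφ, hlim⟩ :=
    (isCompact_univ_pi fun n : ℕ => isCompact_closedBall (0:ℂ) (e n * M)).tendsto_subseq
      (x := x) fun j n _ => by simpa using hxb j n
  have hyb : ∀ n, ‖y n‖ ≤ e n * M := fun n => by simpa using hy n (mem_univ n)
  set c : ℕ → ℂ := fun n => y n / ((n : ℂ) + 1) with hcdef
  have hne : ∀ n : ℕ, (n : ℂ) + 1 ≠ 0 := fun n => Nat.cast_add_one_ne_zero n
  have hcn : ∀ n : ℕ, ((n : ℝ) + 1) * ‖c n‖ = ‖y n‖ := fun n => by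
    rw [← hn1, ← norm_mul, hcdef, mul_div_cancel₀ _ (hne n)]
  have hcE : ∀ n : ℕ, ((n : ℝ) + 1) * ‖c n‖ ≤ E * M := fun n => by
    rw [hcn]
    exact (hyb n).trans (mul_le_mul_of_nonneg_right (hE' n) hM0)
  refine ⟨φ, powerSum c, hφ, (memBloch_of_coeff_le hcE (eqOn_refl _ _)).1, ?_⟩
  have hpoly : ∀ {d : ℕ → ℂ} {A : ℝ}, (∀ n : ℕ, ((n : ℝ) + 1) * ‖d n‖ ≤ A) →
      ∀ n : ℕ, ‖d n‖ ≤ A * ((n : ℝ) + 1) ^ 0 := fun hd n => by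
    have h1 := hd n
    rw [pow_zero, mul_one]
    refine le_trans ?_ h1
    exact le_mul_of_one_le_left (norm_nonneg _) (by linarith [n.cast_nonneg (α := ℝ)])
  have hdiff : ∀ j, EqOn (fun z => Hop μ α (F (φ j)) z - powerSum c z)
      (powerSum fun n => hopCoeff μ α (F (φ j)) n - c n) (ball 0 1) := by
    intro j z hz
    rw [mem_ball_zero_iff] at hz
    have hs1 := summable_coeff_mul_pow (hpoly fun n => (hc _ (hF (φ j)) n).trans
      (mul_le_mul (hE' n) (hM _) (hardyNorm_nonneg _) hE0)) hz
    have hs2 := summable_coeff_mul_pow (hpoly hcE) hz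
    simp only [Hop_eq_powerSum, powerSum]
    rw [← hs1.tsum_sub hs2]
    exact tsum_congr fun n => by ring
  have hnn : ∀ j, 0 ≤ blochNorm (fun z => Hop μ α (F (φ j)) z - powerSum c z) := fun j => by
    refine add_nonneg (norm_nonneg _) (Real.sSup_nonneg ?_)
    rintro _ ⟨z, hz, rfl⟩
    exact mul_nonneg (by nlinarith [norm_nonneg z]) (norm_nonneg _)
  rw [Metric.tendsto_atTop]
  intro ε hε
  obtain ⟨N, hN⟩ := eventually_atTop.1
    (het.eventually_lt_const (by positivity : 0 < ε / (8 * (M + 1))))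
  have hfinlim : ∀ᶠ j in atTop, ∀ n ∈ Finset.range N, dist (x (φ j) n) (y n) < ε / 4 := by
    rw [Filter.eventually_all_finset]
    intro n _
    have := (tendsto_pi_nhds.1 hlim n)
    exact (Metric.tendsto_nhds.1 this) _ (by positivity)
  obtain ⟨J, hJ⟩ := eventually_atTop.1 hfinlim
  refine ⟨J, fun j hj => ?_⟩
  rw [Real.dist_eq, sub_zero, abs_of_nonneg (hnn j)]
  have hsmall : ∀ n : ℕ, ((n : ℝ) + 1) * ‖hopCoeff μ α (F (φ j)) n - c n‖ ≤ ε / 4 := by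
    intro n
    have e1 : ((n : ℝ) + 1) * ‖hopCoeff μ α (F (φ j)) n - c n‖ = ‖x (φ j) n - y n‖ := by
      rw [← hn1, ← norm_mul, mul_sub, hcdef, mul_div_cancel₀ _ (hne n)]
    rw [e1]
    by_cases hn : n < N
    · rw [← dist_eq_norm]
      exact (hJ j hj n (Finset.mem_range.2 hn)).le
    · have h1 := hN n (not_lt.1 hn)
      have h2 : e n * M ≤ ε / 8 := by
        calc e n * M ≤ ε / (8 * (M + 1)) * (M + 1) :=
              mul_le_mul h1.le (by linarith) hM0 (by positivity)
          _ = ε / 8 := by field_simp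
      linarith [norm_sub_le (x (φ j) n) (y n), hxb (φ j) n, hyb n]
  linarith [(memBloch_of_coeff_le hsmall (hdiff j)).2]

lemma summable_taylorCoeff_mul_moment_of_one_lt {μ : Measure ℝ}
    [IsFiniteMeasure (μ.restrict (Ico 0 1))] {f : ℂ → ℂ} {R : ℝ} (hR : 1 < R)
    (hf : DifferentiableOn ℂ f (ball 0 R)) :
    Summable fun k : ℕ => ‖taylorCoeff f k‖ * ∫ t in Ico (0:ℝ) 1, t ^ k ∂μ := by
  obtain ⟨r, hr1, hrR⟩ := exists_between hR
  have hr0 : 0 < r := by linarith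
  obtain ⟨C, hC⟩ := (isCompact_sphere (0:ℂ) r).exists_bound_of_continuousOn
    (hf.continuousOn.mono (sphere_subset_ball hrR))
  have hC0 : 0 ≤ C := (norm_nonneg _).trans (hC (r : ℂ) (by simp [abs_of_pos hr0]))
  have hd : DiffContOnCl ℂ f (ball 0 r) :=
    (hf.mono (closedBall_subset_ball hrR)).diffContOnCl_ball subset_rfl
  have hint : ∀ k : ℕ, 0 ≤ ∫ t in Ico (0:ℝ) 1, t ^ k ∂μ := fun k =>
    setIntegral_nonneg measurableSet_Ico fun t ht => pow_nonneg ht.1 k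
  set M := ∫ t in Ico (0:ℝ) 1, t ^ 0 ∂μ with hM
  have hs : Summable fun k : ℕ => C * M * (r⁻¹) ^ k :=
    (summable_geometric_of_lt_one (by positivity) (inv_lt_one_of_one_lt₀ hr1)).mul_left _
  refine Summable.of_nonneg_of_le (fun k => mul_nonneg (norm_nonneg _) (hint k)) (fun k => ?_) hs
  have hkf : (0 : ℝ) < k.factorial := by exact_mod_cast k.factorial_pos
  have h1 : ‖taylorCoeff f k‖ ≤ C * (r⁻¹) ^ k := by
    rw [taylorCoeff, norm_div, Complex.norm_natCast, div_le_iff₀ hkf]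
    refine (Complex.norm_iteratedDeriv_le_of_forall_mem_sphere_norm_le k hr0 hd hC).trans ?_
    rw [div_eq_mul_inv, inv_pow]
    exact le_of_eq (by ring)
  have h2 : ∫ t in Ico (0:ℝ) 1, t ^ k ∂μ ≤ M :=
    setIntegral_mono_on (integrableOn_pow μ k) (integrableOn_pow μ 0) measurableSet_Ico
      fun t ht => pow_le_pow_of_le_one ht.1 ht.2.le (Nat.zero_le k)
  calc _ ≤ C * (r⁻¹) ^ k * M := mul_le_mul h1 h2 (hint k) (by positivity)
    _ = _ := by ring

/-- The test functions `(1-a)^(m-1/p) / (1-az)^m`. -/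
def testFun (p : ℝ) (m : ℕ) (a : ℝ) (z : ℂ) : ℂ :=
  (((1 - a) ^ ((m : ℝ) - 1 / p) : ℝ) : ℂ) / (1 - a * z) ^ m

/-- The restriction of `testFun` to the real axis. -/
def testFunReal (p : ℝ) (m : ℕ) (a t : ℝ) : ℝ :=
  (1 - a) ^ ((m : ℝ) - 1 / p) / (1 - a * t) ^ m

lemma testFun_ofReal (p : ℝ) (m : ℕ) (a t : ℝ) :
    testFun p m a t = (testFunReal p m a t : ℂ) := by
  simp [testFun, testFunReal]

lemma differentiableOn_testFun (p : ℝ) (m : ℕ) {a : ℝ} (ha : 0 < a) :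
    DifferentiableOn ℂ (testFun p m a) (ball 0 a⁻¹) := by
  unfold testFun
  refine DifferentiableOn.div (by fun_prop) (by fun_prop) fun z hz => pow_ne_zero m ?_
  intro h
  rw [mem_ball_zero_iff] at hz
  have h1 : (a : ℂ) * z = 1 := (sub_eq_zero.1 h).symm
  have h2 : a * ‖z‖ = 1 := by
    have := congrArg norm h1
    simpa [abs_of_pos ha] using this
  have h3 : a * ‖z‖ < a * a⁻¹ := mul_lt_mul_of_pos_left hz ha
  rw [mul_inv_cancel₀ ha.ne'] at h3
  linarith

lemma circleAverage_poissonKernel {w : ℂ} (hw : ‖w‖ < 1) :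
    Real.circleAverage (poissonKernel 0 w) 0 1 = 1 := by
  have h := DiffContOnCl.circleAverage_poissonKernel_smul (f := fun _ : ℂ => (1:ℂ)) (c := 0)
    (R := 1) (w := w) diffContOnCl_const (by simpa using hw)
  have e : (poissonKernel 0 w • fun _ : ℂ => (1:ℂ)) = fun z => ((poissonKernel 0 w z : ℝ) : ℂ) := by
    ext z
    simp
  rw [e, Real.circleAverage, intervalIntegral.integral_ofReal] at h
  rw [Real.circleAverage, smul_eq_mul]
  rw [Complex.real_smul] at h
  exact_mod_cast h

lemma norm_circleMap_sub_ofReal (ρ θ : ℝ) :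
    ‖circleMap 0 1 θ - ρ‖ = ‖1 - ρ * Complex.exp (θ * Complex.I)‖ := by
  have h : ‖circleMap 0 1 θ - ρ‖ ^ 2 = ‖1 - ρ * Complex.exp (θ * Complex.I)‖ ^ 2 := by
    rw [Complex.sq_norm, Complex.sq_norm, Complex.normSq_apply, Complex.normSq_apply]
    simp only [circleMap, zero_add, Complex.ofReal_one, one_mul, Complex.sub_re, Complex.sub_im,
      Complex.mul_re, Complex.mul_im, Complex.exp_ofReal_mul_I_re, Complex.exp_ofReal_mul_I_im,
      Complex.ofReal_re, Complex.ofReal_im, Complex.one_re, Complex.one_im]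
    linear_combination (1 - ρ ^ 2) * Real.sin_sq_add_cos_sq θ
  exact (pow_left_inj₀ (norm_nonneg _) (norm_nonneg _) two_ne_zero).1 h

lemma hardySet_testFun_le {p : ℝ} (hp : 0 < p) {m : ℕ} (hm : 2 ≤ m * p) {a : ℝ} (ha0 : 0 < a)
    (ha1 : a < 1) {y : ℝ} (hy : y ∈ hardySet p (testFun p m a)) : y ≤ 1 := by
  obtain ⟨r, hr0, hr1, rfl⟩ := hy
  have h1a : 0 < 1 - a := by linarith
  set ρ : ℝ := a * r with hρ
  have hρ0 : 0 < ρ := by positivity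
  have hρa : ρ ≤ a := mul_le_of_le_one_right ha0.le hr1.le
  have hρ1 : ρ < 1 := by linarith
  have hnw : ‖(ρ : ℂ)‖ = ρ := by rw [Complex.norm_real, Real.norm_of_nonneg hρ0.le]
  have hlow : ∀ θ : ℝ, 1 - a ≤ ‖1 - (ρ : ℂ) * Complex.exp (θ * Complex.I)‖ := fun θ => by
    have h1 := norm_sub_norm_le (1 : ℂ) ((ρ : ℂ) * Complex.exp (θ * Complex.I))
    rw [norm_mul, Complex.norm_exp_ofReal_mul_I, hnw, norm_one, mul_one] at h1
    linarith
  have hK : 0 ≤ (1 - a) / (1 - ρ ^ 2) := div_nonneg h1a.le (by nlinarith)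
  have hpt : ∀ θ : ℝ, ‖testFun p m a ((r : ℂ) * Complex.exp (θ * Complex.I))‖ ^ p ≤
      (1 - a) / (1 - ρ ^ 2) * poissonKernel 0 ρ (circleMap 0 1 θ) := by
    intro θ
    set X := ‖1 - (ρ : ℂ) * Complex.exp (θ * Complex.I)‖ with hX
    have hXl : 1 - a ≤ X := hlow θ
    have hX0 : 0 < X := h1a.trans_le hXl
    have e1 : ‖testFun p m a ((r : ℂ) * Complex.exp (θ * Complex.I))‖ =
        (1 - a) ^ ((m : ℝ) - 1 / p) / X ^ m := by
      rw [testFun, norm_div, norm_pow, Complex.norm_real, Real.norm_of_nonneg (by positivity),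
        ← mul_assoc, ← Complex.ofReal_mul]
    have e2 : poissonKernel 0 ρ (circleMap 0 1 θ) = (1 - ρ ^ 2) / X ^ 2 := by
      simp only [poissonKernel, sub_zero]
      rw [norm_circleMap_sub_ofReal, hnw]
      simp [hX]
    have h1ρ : 1 - ρ ^ 2 ≠ 0 := by nlinarith
    have e3 : (1 - a) / (1 - ρ ^ 2) * ((1 - ρ ^ 2) / X ^ 2) = (1 - a) / X ^ 2 := by
      field_simp
    rw [e1, e2, e3, Real.div_rpow (by positivity) (by positivity), ← Real.rpow_mul h1a.le,
      ← Real.rpow_natCast X m, ← Real.rpow_mul hX0.le]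
    have h2 : (1 - a) ^ (((m : ℝ) - 1 / p) * p) = (1 - a) ^ ((m : ℝ) * p - 2) * (1 - a) := by
      rw [← Real.rpow_add_one h1a.ne']
      congr 1
      field_simp
      ring
    have h3 : X ^ ((m : ℝ) * p) = X ^ ((m : ℝ) * p - 2) * X ^ 2 := by
      rw [← Real.rpow_natCast X 2, ← Real.rpow_add hX0]
      congr 1
      push_cast
      ring
    rw [h2, h3, div_le_div_iff₀ (by positivity) (by positivity)]
    have h4 : (1 - a) ^ ((m : ℝ) * p - 2) ≤ X ^ ((m : ℝ) * p - 2) :=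
      Real.rpow_le_rpow h1a.le hXl (by linarith)
    have h5 := mul_le_mul_of_nonneg_right h4 (by positivity : 0 ≤ (1 - a) * X ^ 2)
    linarith
  have hle : (2 * Real.pi)⁻¹ * ∫ θ in (0:ℝ)..(2 * Real.pi),
      ‖testFun p m a ((r : ℂ) * Complex.exp (θ * Complex.I))‖ ^ p ≤ 1 := by
    have hcP : Continuous fun θ => poissonKernel 0 ρ (circleMap 0 1 θ) := by
      simp only [poissonKernel, sub_zero]
      refine Continuous.div (by fun_prop) (by fun_prop) fun θ => ?_
      rw [norm_circleMap_sub_ofReal]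
      exact pow_ne_zero 2 (h1a.trans_le (hlow θ)).ne'
    have hcf : Continuous fun θ : ℝ =>
        ‖testFun p m a ((r : ℂ) * Complex.exp (θ * Complex.I))‖ ^ p := by
      refine Continuous.rpow_const (Continuous.norm ?_) fun _ => Or.inr hp.le
      refine (differentiableOn_testFun p m ha0).continuousOn.comp_continuous (by fun_prop)
        fun θ => ?_
      rw [mem_ball_zero_iff, norm_mul, Complex.norm_exp_ofReal_mul_I, Complex.norm_real,
        Real.norm_of_nonneg hr0.le, mul_one]
      exact hr1.trans (one_lt_inv_iff₀.2 ⟨ha0, ha1⟩)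
    have h1 := intervalIntegral.integral_mono_on (μ := volume) (by positivity : (0:ℝ) ≤ 2 * Real.pi)
      (hcf.intervalIntegrable _ _) ((hcP.const_mul _).intervalIntegrable _ _)
      fun θ _ => hpt θ
    have h2 := circleAverage_poissonKernel (w := ρ) (by rwa [hnw])
    rw [Real.circleAverage, smul_eq_mul] at h2
    rw [intervalIntegral.integral_const_mul] at h1
    calc _ ≤ (2 * Real.pi)⁻¹ * ((1 - a) / (1 - ρ ^ 2) *
          ∫ θ in (0:ℝ)..(2 * Real.pi), poissonKernel 0 ρ (circleMap 0 1 θ)) :=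
          mul_le_mul_of_nonneg_left h1 (by positivity)
      _ = (1 - a) / (1 - ρ ^ 2) := by rw [mul_left_comm, h2, mul_one]
      _ ≤ 1 := by
          rw [div_le_one (by nlinarith)]
          nlinarith
  refine Real.rpow_le_one (mul_nonneg (by positivity) ?_) hle (by positivity)
  exact intervalIntegral.integral_nonneg (by positivity) fun θ _ => by positivity

lemma memHp_testFun {p : ℝ} (hp : 0 < p) {m : ℕ} (hm : 2 ≤ m * p) {a : ℝ} (ha0 : 0 < a)
    (ha1 : a < 1) : MemHp p (testFun p m a) :=
  ⟨(differentiableOn_testFun p m ha0).mono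
    (ball_subset_ball (one_lt_inv_iff₀.2 ⟨ha0, ha1⟩).le),
    1, fun _ hy => hardySet_testFun_le hp hm ha0 ha1 hy⟩

lemma hardyNorm_testFun_le {p : ℝ} (hp : 0 < p) {m : ℕ} (hm : 2 ≤ m * p) {a : ℝ} (ha0 : 0 < a)
    (ha1 : a < 1) : hardyNorm p (testFun p m a) ≤ 1 :=
  Real.sSup_le (fun _ hy => hardySet_testFun_le hp hm ha0 ha1 hy) zero_le_one

lemma testFunReal_nonneg (p : ℝ) (m : ℕ) {a t : ℝ} (ha0 : 0 < a) (ha1 : a < 1)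
    (ht : t ∈ Ico (0:ℝ) 1) : 0 ≤ testFunReal p m a t := by
  have : 0 ≤ 1 - a := by linarith
  have : 0 ≤ 1 - a * t := by nlinarith [ht.1, ht.2]
  unfold testFunReal
  positivity

/-- The moments `∫ t^n f_a(t) dμ(t)` of the test functions. -/
def testMoment (μ : Measure ℝ) (p : ℝ) (m : ℕ) (a : ℝ) (n : ℕ) : ℝ :=
  ∫ t in Ico (0:ℝ) 1, t ^ n * testFunReal p m a t ∂μ

lemma integrableOn_testFunReal {μ : Measure ℝ} [IsFiniteMeasure (μ.restrict (Ico 0 1))]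
    (p : ℝ) (m : ℕ) {a : ℝ} (ha0 : 0 < a) (ha1 : a < 1) (n : ℕ) :
    IntegrableOn (fun t => t ^ n * testFunReal p m a t) (Ico 0 1) μ := by
  have h1a : 0 < 1 - a := by linarith
  refine Integrable.of_bound (by unfold testFunReal; fun_prop)
    ((1 - a) ^ ((m : ℝ) - 1 / p) / (1 - a) ^ m) ?_
  refine (ae_restrict_iff' measurableSet_Ico).2 (Eventually.of_forall fun t ht => ?_)
  have h0 := testFunReal_nonneg p m ha0 ha1 ht
  rw [Real.norm_of_nonneg (mul_nonneg (pow_nonneg ht.1 n) h0)]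
  refine (mul_le_of_le_one_left h0 (pow_le_one₀ ht.1 ht.2.le)).trans ?_
  unfold testFunReal
  have h2 : 1 - a ≤ 1 - a * t := by nlinarith [ht.2]
  gcongr

lemma testMoment_nonneg (μ : Measure ℝ) (p : ℝ) (m : ℕ) {a : ℝ} (ha0 : 0 < a) (ha1 : a < 1)
    (n : ℕ) : 0 ≤ testMoment μ p m a n :=
  setIntegral_nonneg measurableSet_Ico fun _ ht =>
    mul_nonneg (pow_nonneg ht.1 n) (testFunReal_nonneg p m ha0 ha1 ht)

lemma testMoment_le {μ : Measure ℝ} [IsFiniteMeasure (μ.restrict (Ico 0 1))]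
    (p : ℝ) (m : ℕ) {a : ℝ} (ha0 : 0 < a) (ha1 : a < 1) (n : ℕ) :
    testMoment μ p m a n ≤ testMoment μ p m a 0 :=
  setIntegral_mono_on (integrableOn_testFunReal p m ha0 ha1 n)
    (integrableOn_testFunReal p m ha0 ha1 0) measurableSet_Ico fun _ ht =>
      mul_le_mul_of_nonneg_right (pow_le_pow_of_le_one ht.1 ht.2.le (Nat.zero_le n))
        (testFunReal_nonneg p m ha0 ha1 ht)

lemma hopCoeff_testFun {μ : Measure ℝ} [IsFiniteMeasure (μ.restrict (Ico 0 1))] (α p : ℝ)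
    (m : ℕ) {a : ℝ} (ha0 : 0 < a) (ha1 : a < 1) (n : ℕ) :
    hopCoeff μ α (testFun p m a) n = ((hilbertWeight α n * testMoment μ p m a n : ℝ) : ℂ) := by
  have hR : 1 < a⁻¹ := one_lt_inv_iff₀.2 ⟨ha0, ha1⟩
  have hd := differentiableOn_testFun p m ha0
  rw [hopCoeff_eq_integral (hd.mono (ball_subset_ball hR.le))
    (summable_taylorCoeff_mul_moment_of_one_lt hR hd), testMoment, Complex.ofReal_mul,
    ← integral_complex_ofReal]
  congr 2
  ext t
  rw [testFun_ofReal]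
  push_cast
  ring

lemma testFunReal_ge (p : ℝ) (m : ℕ) {a t : ℝ} (ha0 : 0 < a) (hat : a ≤ t) (ht1 : t < 1) :
    (2 ^ m)⁻¹ * (1 - a) ^ (-(1 / p)) ≤ testFunReal p m a t := by
  have h1a : 0 < 1 - a := by linarith
  have h1 : 0 < 1 - a * t := by nlinarith
  have h2 : (1 - a * t) ^ m ≤ 2 ^ m * (1 - a) ^ m := by
    rw [← mul_pow]
    exact pow_le_pow_left₀ h1.le (by nlinarith) m
  unfold testFunReal
  rw [le_div_iff₀ (by positivity), sub_eq_add_neg (m : ℝ),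
    Real.rpow_add h1a, Real.rpow_natCast]
  have h3 : 0 < (1 - a) ^ (-(1 / p)) := by positivity
  calc (2 ^ m)⁻¹ * (1 - a) ^ (-(1 / p)) * (1 - a * t) ^ m
      ≤ (2 ^ m)⁻¹ * (1 - a) ^ (-(1 / p)) * (2 ^ m * (1 - a) ^ m) :=
        mul_le_mul_of_nonneg_left h2 (by positivity)
    _ = _ := by field_simp

lemma testMoment_ge {μ : Measure ℝ} [IsFiniteMeasure (μ.restrict (Ico 0 1))]
    (p : ℝ) (m : ℕ) {a : ℝ} (ha0 : 0 < a) (ha1 : a < 1) (n : ℕ) :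
    a ^ n * ((2 ^ m)⁻¹ * (1 - a) ^ (-(1 / p))) * (μ (Ico a 1)).toReal ≤ testMoment μ p m a n := by
  have h1a : 0 < 1 - a := by linarith
  have hsub : Ico a 1 ⊆ Ico (0:ℝ) 1 := Ico_subset_Ico_left ha0.le
  have hi := integrableOn_testFunReal (μ := μ) p m ha0 ha1 n
  have hfin : μ (Ico (0:ℝ) 1) ≠ ⊤ := by
    have := measure_ne_top (μ.restrict (Ico (0:ℝ) 1)) univ
    simpa using this
  have hfa : μ (Ico a 1) ≠ ⊤ := ne_top_of_le_ne_top hfin (measure_mono hsub)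
  calc _ = ∫ _ in Ico a 1, a ^ n * ((2 ^ m)⁻¹ * (1 - a) ^ (-(1 / p))) ∂μ := by
        rw [setIntegral_const, smul_eq_mul, mul_comm]
        rfl
    _ ≤ ∫ t in Ico a 1, t ^ n * testFunReal p m a t ∂μ := by
        refine setIntegral_mono_on (integrableOn_const hfa) (hi.mono_set hsub)
          measurableSet_Ico fun t ht => ?_
        exact mul_le_mul (pow_le_pow_left₀ ha0.le ht.1 n) (testFunReal_ge p m ha0 ht.1 ht.2)
          (by positivity) (pow_nonneg (ha0.le.trans ht.1) n)
    _ ≤ _ := by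
        refine setIntegral_mono_set hi ?_ hsub.eventuallyLE
        exact (ae_restrict_iff' measurableSet_Ico).2 (Eventually.of_forall fun t ht =>
          mul_nonneg (pow_nonneg ht.1 n) (testFunReal_nonneg p m ha0 ha1 ht))

lemma exists_norm_hopCoeff_testFun_le {α : ℝ} (hα : 0 < α) (p : ℝ) (m : ℕ) :
    ∃ (C : ℝ) (d : ℕ), 0 < C ∧ ∀ (μ : Measure ℝ) [IsFiniteMeasure (μ.restrict (Ico 0 1))]
      (a : ℝ), 0 < a → a < 1 → ∀ n : ℕ,
      ‖hopCoeff μ α (testFun p m a) n‖ ≤ C * testMoment μ p m a 0 * ((n : ℝ) + 1) ^ d := by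
  obtain ⟨_, C, _, hC, hw⟩ := exists_hilbertWeight_bounds hα
  refine ⟨C, ⌈α - 1⌉₊, hC, fun μ _ a ha0 ha1 n => ?_⟩
  have h0 := testMoment_nonneg μ p m ha0 ha1
  rw [hopCoeff_testFun α p m ha0 ha1, Complex.norm_real,
    Real.norm_of_nonneg (mul_nonneg (hilbertWeight_pos hα n).le (h0 n))]
  have h1 : ((n : ℝ) + 1) ^ (α - 1) ≤ ((n : ℝ) + 1) ^ ⌈α - 1⌉₊ := by
    rw [← Real.rpow_natCast]
    exact Real.rpow_le_rpow_of_exponent_le (by linarith [n.cast_nonneg (α := ℝ)]) (Nat.le_ceil _)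
  calc _ ≤ (C * ((n : ℝ) + 1) ^ ⌈α - 1⌉₊) * testMoment μ p m a 0 :=
        mul_le_mul ((hw n).2.trans (mul_le_mul_of_nonneg_left h1 hC.le))
          (testMoment_le p m ha0 ha1 n) (h0 n) (by positivity)
    _ = _ := by ring

lemma exists_norm_powerSum_le (d : ℕ) {z : ℂ} (hz : ‖z‖ < 1) :
    ∃ S : ℝ, ∀ (c : ℕ → ℂ) (K : ℝ), (∀ n, ‖c n‖ ≤ K * ((n : ℝ) + 1) ^ d) →
      ‖powerSum c z‖ ≤ K * S := by
  obtain ⟨ρ, hρ1, hρ2⟩ := exists_between hz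
  have hρ0 : 0 < ρ := (norm_nonneg z).trans_lt hρ1
  refine ⟨_, fun c K hc => tsum_of_norm_bounded
    ((summable_succ_pow_mul_geometric d hρ0 hρ2).hasSum.mul_left K) fun n => ?_⟩
  rw [norm_mul, norm_pow, ← mul_assoc]
  exact mul_le_mul (hc n) (pow_le_pow_left₀ (norm_nonneg z) hρ1.le n) (by positivity)
    ((norm_nonneg _).trans (hc n))

/-- At a fixed point the derivative of `𝓗_{μ,α} f_a` is controlled by `∫ f_a dμ`. -/
lemma exists_norm_deriv_Hop_testFun_le {α : ℝ} (hα : 0 < α) (p : ℝ) (m : ℕ) (μ : Measure ℝ)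
    [IsFiniteMeasure (μ.restrict (Ico 0 1))] {z : ℂ} (hz : ‖z‖ < 1) :
    ∃ S : ℝ, ∀ a : ℝ, 0 < a → a < 1 →
      ‖deriv (Hop μ α (testFun p m a)) z‖ ≤ S * testMoment μ p m a 0 := by
  obtain ⟨C, d, hC, hc⟩ := exists_norm_hopCoeff_testFun_le hα p m
  obtain ⟨S, hS⟩ := exists_norm_powerSum_le (d + 1) hz
  refine ⟨C * 2 ^ d * S, fun a ha0 ha1 => ?_⟩
  rw [Hop_eq_powerSum, deriv_powerSum (hc μ a ha0 ha1) hz]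
  refine (hS _ _ (coeff_deriv_bound (hc μ a ha0 ha1))).trans (le_of_eq ?_)
  ring

lemma exp_neg_le_pow {a : ℝ} (ha : 1 / 2 ≤ a) (ha1 : a < 1) {k : ℕ} {B : ℝ}
    (hk : (k : ℝ) * (1 - a) ≤ B) : Real.exp (-(2 * B)) ≤ a ^ k := by
  have ha0 : 0 < a := by linarith
  have h1 := Real.one_sub_inv_le_log_of_pos ha0
  have h2 : -(2 * (1 - a)) ≤ 1 - a⁻¹ := by
    have : a⁻¹ * a = 1 := inv_mul_cancel₀ ha0.ne'
    have h3 : a⁻¹ ≤ 2 := by rw [inv_le_comm₀ ha0 two_pos]; linarith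
    nlinarith
  rw [← Real.exp_log (pow_pos ha0 k), Real.log_pow]
  refine Real.exp_le_exp.2 ?_
  have h3 := mul_le_mul_of_nonneg_left (h2.trans h1) k.cast_nonneg
  nlinarith

/-- The derivative of `𝓗_{μ,α} f_a` at `a` detects the tail `μ([a,1))`. -/
lemma exists_tail_le_deriv_Hop_testFun {α : ℝ} (hα : 1 < α) (p : ℝ) (m : ℕ) :
    ∃ c : ℝ, 0 < c ∧ ∀ (μ : Measure ℝ) [IsFiniteMeasure (μ.restrict (Ico 0 1))] (a : ℝ),
      1 / 2 ≤ a → a < 1 → c * (1 - a) ^ (-(1 / p + α)) * (μ (Ico a 1)).toReal ≤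
        (1 - ‖(a : ℂ)‖ ^ 2) * ‖deriv (Hop μ α (testFun p m a)) a‖ := by
  have hα0 : 0 < α := by linarith
  obtain ⟨c, _, hc, _, hw⟩ := exists_hilbertWeight_bounds hα0
  obtain ⟨C, d, hC, hcoef⟩ := exists_norm_hopCoeff_testFun_le hα0 p m
  refine ⟨c * Real.exp (-(2 * 8)) * (2 ^ m)⁻¹, by positivity, fun μ _ a ha ha1 => ?_⟩
  have ha0 : 0 < a := by linarith
  have h1a : 0 < 1 - a := by linarith
  have hna : ‖(a : ℂ)‖ = a := by rw [Complex.norm_real, Real.norm_of_nonneg ha0.le]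
  set N : ℕ := ⌈(1 - a)⁻¹⌉₊ with hN
  have hN1 : (1 - a)⁻¹ ≤ N := Nat.le_ceil _
  have hN2 : (N : ℝ) * (1 - a) ≤ 2 := by
    have h1 : (N : ℝ) < (1 - a)⁻¹ + 1 := Nat.ceil_lt_add_one (by positivity)
    have h2 : (1 - a)⁻¹ * (1 - a) = 1 := inv_mul_cancel₀ h1a.ne'
    nlinarith
  have hNpos : (0 : ℝ) < N := lt_of_lt_of_le (by positivity) hN1
  set T := (μ (Ico a 1)).toReal
  have hT : 0 ≤ T := ENNReal.toReal_nonneg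
  set Q := (2 ^ m)⁻¹ * (1 - a) ^ (-(1 / p)) with hQ
  have hQ0 : 0 < Q := by positivity
  set x : ℕ → ℝ := fun n =>
    ((n : ℝ) + 1) * (hilbertWeight α (n + 1) * testMoment μ p m a (n + 1)) * a ^ n with hx
  have hx0 : ∀ n, 0 ≤ x n := fun n => by
    have := hilbertWeight_pos hα0 (n + 1)
    have := testMoment_nonneg μ p m ha0 ha1 (n + 1)
    positivity
  have hb := hcoef μ a ha0 ha1
  have hza : ‖(a : ℂ)‖ < 1 := by rw [hna]; exact ha1
  have hterm : ∀ n : ℕ, ((n : ℂ) + 1) * hopCoeff μ α (testFun p m a) (n + 1) * (a : ℂ) ^ n =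
      ((x n : ℝ) : ℂ) := fun n => by
    rw [hopCoeff_testFun α p m ha0 ha1]
    simp only [hx]
    push_cast
    ring
  have hxs : Summable x := by
    have h1 := summable_coeff_mul_pow (coeff_deriv_bound hb) hza
    simp only [hterm] at h1
    exact_mod_cast h1
  have hderiv : deriv (Hop μ α (testFun p m a)) a = ((∑' n, x n : ℝ) : ℂ) := by
    rw [Hop_eq_powerSum, deriv_powerSum hb hza, powerSum, Complex.ofReal_tsum]
    exact tsum_congr hterm
  have hxlow : ∀ n ∈ Finset.Ico N (2 * N),
      (N : ℝ) ^ α * (c * Real.exp (-(2 * 8)) * Q * T) ≤ x n := by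
    intro n hn
    obtain ⟨hn1, hn2⟩ := Finset.mem_Ico.1 hn
    have hn1' : (N : ℝ) ≤ n := by exact_mod_cast hn1
    have h1 : c * (N : ℝ) ^ (α - 1) ≤ hilbertWeight α (n + 1) := by
      refine le_trans (mul_le_mul_of_nonneg_left ?_ hc.le) (hw (n + 1)).1
      refine Real.rpow_le_rpow hNpos.le ?_ (by linarith)
      push_cast
      linarith
    have h2 := testMoment_ge (μ := μ) p m ha0 ha1 (n + 1)
    have h3 : Real.exp (-(2 * 8)) ≤ a ^ (n + (n + 1)) := by
      refine exp_neg_le_pow ha ha1 ?_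
      have h4 : ((n + (n + 1) : ℕ) : ℝ) ≤ 4 * N := by
        have : n + (n + 1) ≤ 4 * N := by omega
        exact_mod_cast this
      nlinarith
    have hNα : (N : ℝ) ^ α = N * (N : ℝ) ^ (α - 1) := by
      rw [Real.rpow_sub_one hNpos.ne']
      field_simp
    calc (N : ℝ) ^ α * (c * Real.exp (-(2 * 8)) * Q * T)
        = N * ((c * (N : ℝ) ^ (α - 1)) * (Q * T)) * Real.exp (-(2 * 8)) := by rw [hNα]; ring
      _ ≤ ((n : ℝ) + 1) * (hilbertWeight α (n + 1) * (Q * T)) * a ^ (n + (n + 1)) := by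
          have := hilbertWeight_pos hα0 (n + 1)
          gcongr
          linarith
      _ = ((n : ℝ) + 1) * (hilbertWeight α (n + 1) * (a ^ (n + 1) * Q * T)) * a ^ n := by
          rw [pow_add]; ring
      _ ≤ x n := by
          have := hilbertWeight_pos hα0 (n + 1)
          simp only [hx]
          gcongr
  have hsum : (N : ℝ) * ((N : ℝ) ^ α * (c * Real.exp (-(2 * 8)) * Q * T)) ≤ ∑' n, x n := by
    have h1 := Finset.card_nsmul_le_sum (Finset.Ico N (2 * N)) x _ hxlow
    rw [Nat.card_Ico, two_mul, Nat.add_sub_cancel, nsmul_eq_mul, ← two_mul] at h1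
    exact h1.trans (hxs.sum_le_tsum _ fun n _ => hx0 n)
  have hNpow : (1 - a) ^ (-(α + 1)) ≤ (N : ℝ) * (N : ℝ) ^ α := by
    have e : (N : ℝ) * (N : ℝ) ^ α = (N : ℝ) ^ (α + 1) := by
      rw [Real.rpow_add_one hNpos.ne', mul_comm]
    rw [e, Real.rpow_neg h1a.le, ← Real.inv_rpow h1a.le]
    exact Real.rpow_le_rpow (by positivity) hN1 (by linarith)
  rw [hderiv, hna, Complex.norm_real, Real.norm_of_nonneg (tsum_nonneg hx0)]
  have hpow : (1 - a) ^ (-(1 / p + α)) =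
      (1 - a) * ((1 - a) ^ (-(α + 1)) * (1 - a) ^ (-(1 / p))) := by
    rw [← Real.rpow_add h1a, mul_comm, ← Real.rpow_add_one h1a.ne']
    congr 1
    ring
  calc c * Real.exp (-(2 * 8)) * (2 ^ m)⁻¹ * (1 - a) ^ (-(1 / p + α)) * T
      = (1 - a) * ((1 - a) ^ (-(α + 1)) * (c * Real.exp (-(2 * 8)) * Q * T)) := by
        rw [hpow, hQ]; ring
    _ ≤ (1 - a) * ((N * (N : ℝ) ^ α) * (c * Real.exp (-(2 * 8)) * Q * T)) := by gcongr
    _ ≤ (1 - a ^ 2) * ∑' n, x n := by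
        refine mul_le_mul (by nlinarith) (by linarith [hsum]) (by positivity) (by nlinarith)

lemma BoundedHpToBloch.isCarleson {p α : ℝ} (hp : 0 < p) (hα : 1 < α) {μ : Measure ℝ}
    (hfin : μ (Ico 0 1) < ⊤) (h : BoundedHpToBloch μ α p) : IsCarleson μ (1 / p + α) := by
  have hp' : 0 < 1 / p := by positivity
  have : IsFiniteMeasure (μ.restrict (Ico 0 1)) := ⟨by simpa using hfin⟩
  obtain ⟨hB, C, hC, hbd⟩ := h
  obtain ⟨m, hm⟩ := exists_nat_ge (2 / p)
  rw [div_le_iff₀ hp] at hm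
  obtain ⟨c, hc, htail⟩ := exists_tail_le_deriv_Hop_testFun hα p m
  refine isCarleson_of_tail_le (b := 1 / 2) (C := C / c) (by linarith) hfin (by norm_num)
    (by positivity) fun t ht ht1 => ?_
  have ht0 : 0 < t := by linarith
  have h1t : 0 < 1 - t := by linarith
  have hmem := memHp_testFun hp hm ht0 ht1
  have hnt : ‖(t : ℂ)‖ < 1 := by rwa [Complex.norm_real, Real.norm_of_nonneg ht0.le]
  have h1 := (htail μ t ht ht1).trans ((le_blochNorm (hB _ hmem) hnt).trans (hbd _ hmem))
  have h2 : C * hardyNorm p (testFun p m t) ≤ C :=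
    mul_le_of_le_one_right hC.le (hardyNorm_testFun_le hp hm ht0 ht1)
  have hfa : μ (Ico t 1) ≠ ⊤ :=
    ne_top_of_le_ne_top hfin.ne (measure_mono (Ico_subset_Ico_left ht0.le))
  rw [← ENNReal.ofReal_toReal hfa]
  refine ENNReal.ofReal_le_ofReal ?_
  have h3 := h1.trans h2
  rw [Real.rpow_neg h1t.le] at h3
  have hpos : 0 < (1 - t) ^ (1 / p + α) := by positivity
  rw [div_mul_eq_mul_div, le_div_iff₀ hc]
  calc (μ (Ico t 1)).toReal * c = (c * ((1 - t) ^ (1 / p + α))⁻¹ * (μ (Ico t 1)).toReal) *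
        (1 - t) ^ (1 / p + α) := by field_simp
    _ ≤ _ := mul_le_mul_of_nonneg_right h3 hpos.le

lemma testFunReal_le {p : ℝ} (hp : 0 < 1 / p) {m : ℕ} (hm : 1 / p ≤ m) {a t : ℝ} (ha0 : 0 < a)
    (ha1 : a < 1) (ht : t ∈ Ico (0:ℝ) 1) : testFunReal p m a t ≤ (1 - t) ^ (-(1 / p)) := by
  have h1a : 0 < 1 - a := by linarith
  have h1t : 0 < 1 - t := by linarith [ht.2]
  have hat : 1 - a ≤ 1 - a * t := by nlinarith [ht.2]
  have hX : 0 < 1 - a * t := h1a.trans_le hat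
  unfold testFunReal
  rw [div_le_iff₀ (by positivity)]
  have e : (1 - a * t) ^ m = (1 - a * t) ^ ((m : ℝ) - 1 / p) * (1 - a * t) ^ (1 / p) := by
    rw [← Real.rpow_add hX, sub_add_cancel, Real.rpow_natCast]
  rw [e]
  have h3 : (1 - a) ^ ((m : ℝ) - 1 / p) ≤ (1 - a * t) ^ ((m : ℝ) - 1 / p) :=
    Real.rpow_le_rpow h1a.le hat (by linarith)
  have h4 : 1 ≤ (1 - t) ^ (-(1 / p)) * (1 - a * t) ^ (1 / p) := by
    rw [Real.rpow_neg h1t.le, ← div_eq_inv_mul, one_le_div (by positivity)]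
    exact Real.rpow_le_rpow h1t.le (by nlinarith [ht.1]) hp.le
  calc (1 - a) ^ ((m : ℝ) - 1 / p) ≤ (1 - a * t) ^ ((m : ℝ) - 1 / p) * 1 := by rwa [mul_one]
    _ ≤ (1 - a * t) ^ ((m : ℝ) - 1 / p) * ((1 - t) ^ (-(1 / p)) * (1 - a * t) ^ (1 / p)) :=
        mul_le_mul_of_nonneg_left h4 (by positivity)
    _ = _ := by ring

lemma tendsto_testMoment_zero {p α : ℝ} (hp : 0 < p) (hα : 1 < α) {m : ℕ} (hm : 2 ≤ m * p)
    {μ : Measure ℝ} (hμ : IsCarleson μ (1 / p + α)) {a : ℕ → ℝ}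
    (ha0 : ∀ j, 0 < a j) (ha1 : ∀ j, a j < 1) (hlim : Tendsto a atTop (𝓝 1)) :
    Tendsto (fun j => testMoment μ p m (a j) 0) atTop (𝓝 0) := by
  have hp' : 0 < 1 / p := by positivity
  have hmp : 1 / p < m := by rw [div_lt_iff₀ hp]; linarith
  obtain ⟨K, -, hK⟩ := hμ.exists_singularMoment_le hp'.le (by linarith)
  have hint := integrableOn_of_singularMoment_ne_top ((hK 0).trans_lt ENNReal.ofReal_lt_top).ne
  have e : (0 : ℝ) = ∫ t in Ico (0:ℝ) 1, (0 : ℝ) ∂μ := by simp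
  rw [e]
  refine tendsto_integral_of_dominated_convergence _
    (fun j => by unfold testFunReal; fun_prop) hint (fun j => ?_) ?_
  · refine (ae_restrict_iff' measurableSet_Ico).2 (Eventually.of_forall fun t ht => ?_)
    have h0 := testFunReal_nonneg p m (ha0 j) (ha1 j) ht
    rw [pow_zero, one_mul, one_mul, Real.norm_of_nonneg h0]
    exact testFunReal_le hp' hmp.le (ha0 j) (ha1 j) ht
  · refine (ae_restrict_iff' measurableSet_Ico).2 (Eventually.of_forall fun t ht => ?_)
    have h1t : 1 - 1 * t ≠ 0 := by have := ht.2; intro h; linarith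
    have h1 : Tendsto (fun j => (1 - a j) ^ ((m : ℝ) - 1 / p)) atTop (𝓝 0) := by
      have h2 := (hlim.const_sub 1).rpow_const (p := (m : ℝ) - 1 / p) (Or.inr (by linarith))
      rwa [sub_self, Real.zero_rpow (by linarith)] at h2
    have h2 : Tendsto (fun j => (1 - a j * t) ^ m) atTop (𝓝 ((1 - 1 * t) ^ m)) :=
      ((hlim.mul_const t).const_sub 1).pow m
    have h3 := h1.div h2 (pow_ne_zero m h1t)
    rw [zero_div] at h3
    simp only [pow_zero, one_mul, testFunReal]
    exact h3

lemma CompactHpToBloch.isVanishingCarleson {p α : ℝ} (hp : 0 < p) (hα : 1 < α)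
    {μ : Measure ℝ} (hfin : μ (Ico 0 1) < ⊤) (h : CompactHpToBloch μ α p) :
    IsVanishingCarleson μ (1 / p + α) := by
  have hcar := h.1.isCarleson hp hα hfin
  have : IsFiniteMeasure (μ.restrict (Ico 0 1)) := ⟨by simpa using hfin⟩
  obtain ⟨m, hm⟩ := exists_nat_ge (2 / p)
  rw [div_le_iff₀ hp] at hm
  obtain ⟨c, hc, htail⟩ := exists_tail_le_deriv_Hop_testFun hα p m
  refine tendsto_of_subseq_tendsto fun a' ha' => ?_
  have hev : ∀ᶠ j in atTop, a' j ∈ Ico (1 / 2 : ℝ) 1 :=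
    ha'.eventually (Ico_mem_nhdsLT (by norm_num))
  obtain ⟨J, hJ⟩ := eventually_atTop.1 hev
  set a : ℕ → ℝ := fun j => a' (j + J) with ha
  have hah : ∀ j, 1 / 2 ≤ a j := fun j => (hJ _ (Nat.le_add_left J j)).1
  have ha1 : ∀ j, a j < 1 := fun j => (hJ _ (Nat.le_add_left J j)).2
  have ha0 : ∀ j, 0 < a j := fun j => by linarith [hah j]
  have halim : Tendsto a atTop (𝓝 1) :=
    (tendsto_add_atTop_iff_nat J).2 (tendsto_nhds_of_tendsto_nhdsWithin ha')
  have hmem : ∀ j, MemHp p (testFun p m (a j)) := fun j => memHp_testFun hp hm (ha0 j) (ha1 j)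
  obtain ⟨φ, g, hφ, hg, hlim⟩ := h.2 (fun j => testFun p m (a j)) hmem
    ⟨1, fun j => hardyNorm_testFun_le hp hm (ha0 j) (ha1 j)⟩
  set H : ℕ → ℂ → ℂ := fun j => Hop μ α (testFun p m (a (φ j))) with hH
  have hHB : ∀ j, MemBloch (H j) := fun j => h.1.1 _ (hmem _)
  have hderiv : ∀ j (z : ℂ), ‖z‖ < 1 →
      deriv (fun z => H j z - g z) z = deriv (H j) z - deriv g z := fun j z hz => by
    have hb : ball (0:ℂ) 1 ∈ 𝓝 z := isOpen_ball.mem_nhds (by simpa using hz)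
    exact deriv_fun_sub ((hHB j).1.differentiableAt hb) (hg.1.differentiableAt hb)
  have hg0 : ∀ z : ℂ, ‖z‖ < 1 → deriv g z = 0 := by
    intro z hz
    have hz2 : 0 < 1 - ‖z‖ ^ 2 := by nlinarith [norm_nonneg z]
    obtain ⟨S, hS⟩ := exists_norm_deriv_Hop_testFun_le (by linarith : 0 < α) p m μ hz
    have hI := (tendsto_testMoment_zero hp hα hm hcar (fun j => ha0 (φ j)) (fun j => ha1 (φ j))
      (halim.comp hφ.tendsto_atTop)).const_mul S
    rw [mul_zero] at hI
    have h1 : Tendsto (fun j => deriv (H j) z) atTop (𝓝 0) :=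
      squeeze_zero_norm (fun j => hS _ (ha0 _) (ha1 _)) hI
    have h2 : Tendsto (fun j => deriv (H j) z - deriv g z) atTop (𝓝 0) := by
      have h3 := hlim.const_mul (1 - ‖z‖ ^ 2)⁻¹
      rw [mul_zero] at h3
      refine squeeze_zero_norm (fun j => ?_) h3
      rw [← hderiv j z hz, inv_mul_eq_div, le_div_iff₀ hz2, mul_comm]
      exact le_blochNorm ((hHB j).sub hg) hz
    have h3 := h1.sub h2
    simp only [sub_sub_cancel, sub_zero] at h3
    exact tendsto_nhds_unique tendsto_const_nhds h3
  refine ⟨fun j => φ j + J, ?_⟩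
  have hlim' := hlim.const_mul c⁻¹
  rw [mul_zero] at hlim'
  have hE := ENNReal.tendsto_ofReal hlim'
  rw [ENNReal.ofReal_zero] at hE
  refine tendsto_of_tendsto_of_tendsto_of_le_of_le tendsto_const_nhds hE
    (fun _ => zero_le) fun j => ?_
  set b := a (φ j) with hb
  have hb0 : 0 < b := ha0 _
  have h1b : 0 < 1 - b := by linarith [ha1 (φ j)]
  have hnb : ‖(b : ℂ)‖ < 1 := by
    rw [Complex.norm_real, Real.norm_of_nonneg hb0.le]; exact ha1 _
  have hpos : 0 < (1 - b) ^ (1 / p + α) := by positivity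
  have h1 := htail μ b (hah _) (ha1 _)
  have h2 := le_blochNorm ((hHB j).sub hg) hnb
  rw [hderiv j b hnb, hg0 b hnb, sub_zero] at h2
  have h3 := h1.trans h2
  have hfa : μ (Ico b 1) ≠ ⊤ :=
    ne_top_of_le_ne_top hfin.ne (measure_mono (Ico_subset_Ico_left hb0.le))
  change μ (Ico b 1) / ENNReal.ofReal ((1 - b) ^ (1 / p + α)) ≤ _
  rw [← ENNReal.ofReal_toReal hfa, ← ENNReal.ofReal_div_of_pos hpos]
  refine ENNReal.ofReal_le_ofReal ?_
  rw [inv_mul_eq_div, le_div_iff₀ hc]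
  refine le_trans (le_of_eq ?_) h3
  rw [Real.rpow_neg h1b.le]
  field_simp

end

/-- For `0 < p < ∞` and `α > 1`, and a positive Borel measure `μ` on `[0,1)` satisfying (T1),
`𝓗_{μ,α} : H^p → ℬ` is compact iff `μ` is a vanishing `(1/p + α)`-Carleson measure. -/
theorem stmt7 (p α : ℝ) (hp : 0 < p) (hα : 1 < α)
    (μ : Measure ℝ) (hμsupp : μ (Ico (0:ℝ) 1)ᶜ = 0) (hT1 : CondT1 p μ) :
    CompactHpToBloch μ α p ↔ IsVanishingCarleson μ (1 / p + α) :=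
  ⟨fun h => h.isVanishingCarleson hp hα hT1.measure_lt_top,
    fun h => h.compactHpToBloch hp hα hT1.measure_lt_top⟩
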